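/- arXiv:2009.12397 — 5 statements merged into one kernel-verified Lean document; each statement's English description precedes it below -/
import Mathlib

section
/- Let X and Y be linear spaces and let A and B be linear relations from X to Y with B(0) ⊆ A(0). Fix n ≥ 1 and define the subspaces M_k and N_k as below. Then the n conditions N_r ⊆ M_{n−r+1} (for r = 1, 2, …, n) are all equivalent to one another; moreover, if N_n ⊆ M_1 holds, then for every k = 1, 2, …, n one has N_k ⊆ D(B) and A(N_{k+1}) ∩ B(N_k) ≠ ∅. -/
open Set

section Defs

variable {X Y : Type*} [AddCommGroup X] [Module ℂ X] [AddCommGroup Y] [Module ℂ Y]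

/-- The domain `D(A)` of a linear relation (given by its graph). -/
def relDom (A : Submodule ℂ (X × Y)) : Set X := {x | ∃ y, (x, y) ∈ A}

/-- The null space `N(A)` of a linear relation. -/
def relKer (A : Submodule ℂ (X × Y)) : Set X := {x | (x, (0 : Y)) ∈ A}

/-- The set `A(0)` of a linear relation. -/
def relMul0 (A : Submodule ℂ (X × Y)) : Set Y := {y | ((0 : X), y) ∈ A}

/-- The image `A(M)` of a set under a linear relation. -/
def relImg (A : Submodule ℂ (X × Y)) (M : Set X) : Set Y := {y | ∃ x ∈ M, (x, y) ∈ A}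

/-- The preimage `A⁻¹(S)` of a set under a linear relation. -/
def relPre (A : Submodule ℂ (X × Y)) (S : Set Y) : Set X := {x | ∃ y ∈ S, (x, y) ∈ A}

/-- The sequence `M_n`: `M_0 = X`, `M_n = B⁻¹(A(M_{n-1}))`. -/
def Mseq (A B : Submodule ℂ (X × Y)) : ℕ → Set X
  | 0 => univ
  | n + 1 => relPre B (relImg A (Mseq A B n))

/-- The sequence `N_n`, indexed so that `Nseq A B k = N_{k+1}`:
`N_1 = N(A)`, `N_n = A⁻¹(B(N_{n-1}))`. -/
def Nseq (A B : Submodule ℂ (X × Y)) : ℕ → Set X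
  | 0 => relKer A
  | n + 1 => relPre A (relImg B (Nseq A B n))

end Defs

section LinearRelations

variable {X Y : Type*} [AddCommGroup X] [Module ℂ X] [AddCommGroup Y] [Module ℂ Y]

lemma relImg_mono (A : Submodule ℂ (X × Y)) {M M' : Set X} (h : M ⊆ M') :
    relImg A M ⊆ relImg A M' :=
  fun _ ⟨x, hx, hxy⟩ => ⟨x, h hx, hxy⟩

lemma relPre_mono (A : Submodule ℂ (X × Y)) {S S' : Set Y} (h : S ⊆ S') :
    relPre A S ⊆ relPre A S' :=
  fun _ ⟨y, hy, hxy⟩ => ⟨y, h hy, hxy⟩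

lemma Mseq_antitone (A B : Submodule ℂ (X × Y)) : Antitone (Mseq A B) := by
  refine antitone_nat_of_succ_le fun n => ?_
  induction n with
  | zero => exact subset_univ _
  | succ n ih => exact relPre_mono B (relImg_mono A ih)

lemma zero_mem_Nseq (A B : Submodule ℂ (X × Y)) (n : ℕ) : (0 : X) ∈ Nseq A B n := by
  induction n with
  | zero => exact A.zero_mem
  | succ n ih => exact ⟨0, ⟨0, ih, B.zero_mem⟩, A.zero_mem⟩

lemma Nseq_monotone (A B : Submodule ℂ (X × Y)) : Monotone (Nseq A B) := by
  refine monotone_nat_of_le_succ fun n => ?_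
  induction n with
  | zero => exact fun x hx => ⟨0, ⟨0, zero_mem_Nseq A B 0, B.zero_mem⟩, hx⟩
  | succ n ih => exact relPre_mono A (relImg_mono B ih)

lemma add_mem_Mseq (A B : Submodule ℂ (X × Y)) (n : ℕ) {x x' : X}
    (hx : x ∈ Mseq A B n) (hx' : x' ∈ Mseq A B n) : x + x' ∈ Mseq A B n := by
  induction n generalizing x x' with
  | zero => exact mem_univ _
  | succ n ih =>
    obtain ⟨y, ⟨w, hw, hwy⟩, hxy⟩ := hx
    obtain ⟨y', ⟨w', hw', hwy'⟩, hxy'⟩ := hx'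
    exact ⟨y + y', ⟨w + w', ih hw hw', A.add_mem hwy hwy'⟩, B.add_mem hxy hxy'⟩

lemma Nseq_succ_subset_Mseq_iff {A B : Submodule ℂ (X × Y)} (h0 : relMul0 B ⊆ relMul0 A)
    (i m : ℕ) :
    Nseq A B (i + 1) ⊆ Mseq A B (m + 1) ↔ Nseq A B i ⊆ Mseq A B (m + 2) := by
  constructor
  · intro h x hx
    obtain ⟨y, ⟨w, -, hwy⟩, hxy⟩ :=
      Mseq_antitone A B (Nat.le_add_left 1 m) (h (Nseq_monotone A B i.le_succ hx))
    exact ⟨y, ⟨w, h ⟨y, ⟨x, hx, hxy⟩, hwy⟩, hwy⟩, hxy⟩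
  · rintro h x ⟨y, ⟨z, hz, hzy⟩, hxy⟩
    obtain ⟨y', ⟨w, hw, hwy'⟩, hzy'⟩ := h hz
    have hmul : ((0 : X), y - y') ∈ A := by
      refine h0 (show ((0 : X), y - y') ∈ B from ?_)
      simpa using B.sub_mem hzy hzy'
    have hker : x - w ∈ relKer A := by
      change (x - w, (0 : Y)) ∈ A
      simpa using A.sub_mem (A.sub_mem hxy hwy') hmul
    have hker_sub : relKer A ⊆ Mseq A B (m + 1) :=
      ((Nseq_monotone A B i.zero_le).trans h).trans (Mseq_antitone A B (m + 1).le_succ)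
    simpa using add_mem_Mseq A B (m + 1) (hker_sub hker) hw

lemma Nseq_subset_Mseq_iff {A B : Submodule ℂ (X × Y)} (h0 : relMul0 B ⊆ relMul0 A)
    (i m : ℕ) :
    Nseq A B i ⊆ Mseq A B (m + 1) ↔ Nseq A B (i + m) ⊆ Mseq A B 1 := by
  induction m generalizing i with
  | zero => rfl
  | succ m ih =>
    rw [← Nseq_succ_subset_Mseq_iff h0, ih, Nat.add_right_comm, Nat.add_assoc]

end LinearRelations

theorem stmt5 {X Y : Type*} [AddCommGroup X] [Module ℂ X] [AddCommGroup Y] [Module ℂ Y]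
    (A B : Submodule ℂ (X × Y)) (h0 : relMul0 B ⊆ relMul0 A) (n : ℕ) (hn : 1 ≤ n) :
    (∀ r s : ℕ, 1 ≤ r → r ≤ n → 1 ≤ s → s ≤ n →
      ((Nseq A B (r - 1) ⊆ Mseq A B (n - r + 1)) ↔
        (Nseq A B (s - 1) ⊆ Mseq A B (n - s + 1)))) ∧
    ((Nseq A B (n - 1) ⊆ Mseq A B 1) →
      ∀ k : ℕ, 1 ≤ k → k ≤ n → Nseq A B (k - 1) ⊆ relDom B ∧
        ((relImg A (Nseq A B k)) ∩ (relImg B (Nseq A B (k - 1)))).Nonempty) := by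
  refine ⟨fun r s hr hrn hs hsn => ?_, fun h k hk hkn => ⟨fun x hx => ?_, 0, ?_, ?_⟩⟩
  · rw [Nseq_subset_Mseq_iff h0 (r - 1), Nseq_subset_Mseq_iff h0 (s - 1) (n - s),
      show r - 1 + (n - r) = s - 1 + (n - s) by omega]
  · obtain ⟨y, -, hxy⟩ := h (Nseq_monotone A B (Nat.sub_le_sub_right hkn 1) hx)
    exact ⟨y, hxy⟩
  · exact ⟨0, zero_mem_Nseq A B k, A.zero_mem⟩
  · exact ⟨0, zero_mem_Nseq A B (k - 1), B.zero_mem⟩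
end

section
/- Let X and Y be Banach spaces and let A and B be closed linear relations from X to Y with D(A) = D(B) = X. Then for every n ≥ 1, M′_n ⊆ (B(N_n))^⊥ and N′_n ⊆ (A(M_{n−1}))^⊥. -/
open Set

section Dual

variable {X Y : Type*} [NormedAddCommGroup X] [NormedSpace ℂ X]
  [NormedAddCommGroup Y] [NormedSpace ℂ Y]

/-- The adjoint relation `A′` from `Y′` to `X′`:
`(y′, x′) ∈ G(A′)` iff `y′(y) = x′(x)` for all `(x, y) ∈ G(A)`. -/
noncomputable def relAdj (A : Submodule ℂ (X × Y)) :
    Submodule ℂ ((Y →L[ℂ] ℂ) × (X →L[ℂ] ℂ)) where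
  carrier := {p | ∀ x y, (x, y) ∈ A → p.1 y = p.2 x}
  add_mem' := by
    intro p q hp hq x y hxy
    simp only [Prod.fst_add, Prod.snd_add, ContinuousLinearMap.add_apply,
      hp x y hxy, hq x y hxy]
  zero_mem' := by intro x y _; simp
  smul_mem' := by
    intro c p hp x y hxy
    simp only [Prod.smul_fst, Prod.smul_snd, ContinuousLinearMap.coe_smul',
      Pi.smul_apply, hp x y hxy]

/-- The annihilator `S^⊥` of a set `S ⊆ Y` in the continuous dual. -/
def annih (S : Set Y) : Set (Y →L[ℂ] ℂ) := {f | ∀ s ∈ S, f s = 0}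

end Dual

section Adjoint

variable {X Y : Type*} [NormedAddCommGroup X] [NormedSpace ℂ X]
  [NormedAddCommGroup Y] [NormedSpace ℂ Y]

theorem Mseq_relAdj_subset_annih (A B : Submodule ℂ (X × Y)) (n : ℕ) :
    Mseq (relAdj A) (relAdj B) (n + 1) ⊆ annih (relImg B (Nseq A B n)) := by
  induction n with
  | zero =>
    rintro f ⟨g, ⟨h, -, hhg⟩, hfg⟩ s ⟨x, hx, hxs⟩
    exact (hfg x s hxs).trans ((hhg x 0 hx).symm.trans (map_zero h))
  | succ n ih =>
    rintro f ⟨g, ⟨h, hh, hhg⟩, hfg⟩ s ⟨x, ⟨t, ht, hxt⟩, hxs⟩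
    exact (hfg x s hxs).trans ((hhg x t hxt).symm.trans (ih hh t ht))

theorem Nseq_relAdj_subset_annih (A B : Submodule ℂ (X × Y)) (n : ℕ) :
    Nseq (relAdj A) (relAdj B) n ⊆ annih (relImg A (Mseq A B n)) := by
  induction n with
  | zero =>
    rintro f hf s ⟨x, -, hxs⟩
    exact hf x s hxs
  | succ n ih =>
    rintro f ⟨g, ⟨h, hh, hhg⟩, hfg⟩ s ⟨x, ⟨t, ht, hxt⟩, hxs⟩
    exact (hfg x s hxs).trans ((hhg x t hxt).symm.trans (ih hh t ht))

end Adjoint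

theorem stmt6 {X Y : Type*} [NormedAddCommGroup X] [NormedSpace ℂ X] [CompleteSpace X]
    [NormedAddCommGroup Y] [NormedSpace ℂ Y] [CompleteSpace Y]
    (A B : Submodule ℂ (X × Y))
    (hA : IsClosed (A : Set (X × Y))) (hB : IsClosed (B : Set (X × Y)))
    (hdomA : relDom A = univ) (hdomB : relDom B = univ) :
    ∀ n : ℕ, 1 ≤ n →
      Mseq (relAdj A) (relAdj B) n ⊆ annih (relImg B (Nseq A B (n - 1))) ∧
      Nseq (relAdj A) (relAdj B) (n - 1) ⊆ annih (relImg A (Mseq A B (n - 1))) := by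
  intro n hn
  obtain ⟨n, rfl⟩ := Nat.exists_eq_add_of_le' hn
  exact ⟨Mseq_relAdj_subset_annih A B n, Nseq_relAdj_subset_annih A B n⟩
end

section
/- Let X and Y be Banach spaces and let A and B be closed linear relations from X to Y with D(A) = D(B) = X, R(A) closed, B(0) ⊆ A(0), and B bounded, i.e. there is C ≥ 0 with dist(z, B(0)) ≤ C·‖x‖ for every (x,z) ∈ G(B). Then M′_1 = (B(N(A)))^⊥, that is, (B′)⁻¹(A′(Y′)) = (B(N(A)))^⊥, where A′(Y′) := {x′ : ∃ y′, (y′,x′) ∈ G(A′)} is the range of the adjoint relation A′. -/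
open Metric Set

section Defs

variable {X Y : Type*} [AddCommGroup X] [Module ℂ X] [AddCommGroup Y] [Module ℂ Y]

/-- The range `R(A)` of a linear relation. -/
def relRan (A : Submodule ℂ (X × Y)) : Set Y := {y | ∃ x, (x, y) ∈ A}

end Defs

/-- A linear functional dominated by `‖T ·‖` factors through `T` via a continuous functional. -/
theorem exists_continuousLinearMap_comp_eq {E F : Type*} [AddCommGroup E] [Module ℂ E]
    [NormedAddCommGroup F] [NormedSpace ℂ F] (T : E →ₗ[ℂ] F) (f : E →ₗ[ℂ] ℂ) (K : ℝ)
    (h : ∀ e, ‖f e‖ ≤ K * ‖T e‖) : ∃ g : F →L[ℂ] ℂ, ∀ e, g (T e) = f e := by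
  obtain ⟨s, hs⟩ := T.rangeRestrict.exists_rightInverse_of_surjective T.range_rangeRestrict
  have hTs : ∀ r, T (s r) = r := fun r => congrArg Subtype.val (LinearMap.congr_fun hs r)
  obtain ⟨g, hg, -⟩ := exists_extension_norm_eq (LinearMap.range T)
    ((f ∘ₗ s).mkContinuous K fun r => by simpa [hTs] using h (s r))
  refine ⟨g, fun e => ?_⟩
  have hge : g (T e) = f (s (T.rangeRestrict e)) := hg (T.rangeRestrict e)
  have hker := h (s (T.rangeRestrict e) - e)
  have hTe : (T.rangeRestrict e : F) = T e := rfl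
  rw [map_sub T, hTs, hTe, sub_self, norm_zero, mul_zero,
    norm_le_zero_iff, map_sub, sub_eq_zero] at hker
  rw [hge, hker]

/-- For a closed relation `A` with closed range, every continuous functional vanishing on `N(A)`
lies in the range of the adjoint. -/
theorem exists_mem_relAdj_of_vanishes_on_relKer {X Y : Type*} [NormedAddCommGroup X]
    [NormedSpace ℂ X] [CompleteSpace X] [NormedAddCommGroup Y] [NormedSpace ℂ Y] [CompleteSpace Y]
    {A : Submodule ℂ (X × Y)} (hA : IsClosed (A : Set (X × Y))) (hRA : IsClosed (relRan A))
    {f : X →L[ℂ] ℂ} (hf : ∀ x ∈ relKer A, f x = 0) : ∃ g, (g, f) ∈ relAdj A := by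
  have hR : ((A.map (LinearMap.snd ℂ X Y) : Submodule ℂ Y) : Set Y) = relRan A := by
    ext y
    simp [relRan]
  have : CompleteSpace A := hA.completeSpace_coe
  have : CompleteSpace (A.map (LinearMap.snd ℂ X Y)) :=
    IsClosed.completeSpace_coe (hs := hR ▸ hRA)
  let T : A →L[ℂ] A.map (LinearMap.snd ℂ X Y) :=
    ((ContinuousLinearMap.snd ℂ X Y).comp A.subtypeL).codRestrict _
      fun a => Submodule.mem_map_of_mem a.2
  have hT : Function.Surjective T := by
    rintro ⟨_, a, ha, rfl⟩
    exact ⟨⟨a, ha⟩, rfl⟩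
  obtain ⟨K, -, hK⟩ := T.exists_preimage_norm_le hT
  obtain ⟨g, hg⟩ := exists_continuousLinearMap_comp_eq (LinearMap.snd ℂ X Y ∘ₗ A.subtype)
    (f.toLinearMap ∘ₗ LinearMap.fst ℂ X Y ∘ₗ A.subtype) (‖f‖ * K) <| by
    intro a
    obtain ⟨b, hb, hbn⟩ := hK (T a)
    have hab : (b : X × Y).2 = (a : X × Y).2 := congrArg Subtype.val hb
    have hfab : f (a : X × Y).1 = f (b : X × Y).1 := by
      rw [← sub_eq_zero, ← map_sub]
      refine hf _ ?_
      have hmem : ((a : X × Y).1 - (b : X × Y).1, (a : X × Y).2 - (b : X × Y).2) ∈ A := (a - b).2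
      rwa [hab, sub_self] at hmem
    calc ‖f (a : X × Y).1‖ = ‖f (b : X × Y).1‖ := by rw [hfab]
      _ ≤ ‖f‖ * ‖(b : X × Y).1‖ := f.le_opNorm _
      _ ≤ ‖f‖ * (K * ‖T a‖) := by gcongr; exact (norm_fst_le (b : X × Y)).trans hbn
      _ = ‖f‖ * K * ‖(a : X × Y).2‖ := by rw [mul_assoc]; rfl
  exact ⟨g, fun x y hxy => hg ⟨(x, y), hxy⟩⟩

/-- For a bounded relation `B`, every continuous functional vanishing on `B(0)` lies in the domain
of the adjoint. -/
theorem exists_mem_relAdj_of_vanishes_on_relMul0 {X Y : Type*} [NormedAddCommGroup X]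
    [NormedSpace ℂ X] [NormedAddCommGroup Y] [NormedSpace ℂ Y]
    {B : Submodule ℂ (X × Y)} {C : ℝ}
    (hbdd : ∀ x z, (x, z) ∈ B → infDist z (relMul0 B) ≤ C * ‖x‖)
    {g : Y →L[ℂ] ℂ} (hg : ∀ y ∈ relMul0 B, g y = 0) : ∃ f, (g, f) ∈ relAdj B := by
  have hne : (relMul0 B).Nonempty := ⟨0, B.zero_mem⟩
  have hdist : ∀ z, ‖g z‖ ≤ ‖g‖ * infDist z (relMul0 B) := by
    intro z
    refine le_of_forall_pos_le_add fun ε hε => ?_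
    have hpos : 0 < ‖g‖ + 1 := by positivity
    obtain ⟨y, hy, hzy⟩ := (infDist_lt_iff hne).1
      (lt_add_of_pos_right (infDist z (relMul0 B)) (div_pos hε hpos))
    calc ‖g z‖ = ‖g (z - y)‖ := by rw [map_sub, hg y hy, sub_zero]
      _ ≤ ‖g‖ * ‖z - y‖ := g.le_opNorm _
      _ ≤ ‖g‖ * (infDist z (relMul0 B) + ε / (‖g‖ + 1)) := by
        rw [← dist_eq_norm]
        gcongr
      _ = ‖g‖ * infDist z (relMul0 B) + ‖g‖ / (‖g‖ + 1) * ε := by ring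
      _ ≤ ‖g‖ * infDist z (relMul0 B) + ε := by
        gcongr
        exact mul_le_of_le_one_left hε.le ((div_le_one hpos).2 (by linarith))
  obtain ⟨f, hf⟩ := exists_continuousLinearMap_comp_eq (LinearMap.fst ℂ X Y ∘ₗ B.subtype)
    (g.toLinearMap ∘ₗ LinearMap.snd ℂ X Y ∘ₗ B.subtype) (‖g‖ * C) fun b => by
      rw [mul_assoc]
      exact (hdist _).trans (mul_le_mul_of_nonneg_left (hbdd _ _ b.2) (norm_nonneg g))
  exact ⟨f, fun x y hxy => (hf ⟨(x, y), hxy⟩).symm⟩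

theorem stmt8 {X Y : Type*} [NormedAddCommGroup X] [NormedSpace ℂ X] [CompleteSpace X]
    [NormedAddCommGroup Y] [NormedSpace ℂ Y] [CompleteSpace Y]
    (A B : Submodule ℂ (X × Y))
    (hA : IsClosed (A : Set (X × Y))) (hB : IsClosed (B : Set (X × Y)))
    (hdomA : relDom A = univ) (hdomB : relDom B = univ)
    (hRA : IsClosed (relRan A)) (h0 : relMul0 B ⊆ relMul0 A)
    (C : ℝ) (hC : 0 ≤ C)
    (hbdd : ∀ x z, (x, z) ∈ B → infDist z (relMul0 B) ≤ C * ‖x‖) :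
    Mseq (relAdj A) (relAdj B) 1 = annih (relImg B (relKer A)) := by
  ext g
  constructor
  · rintro ⟨f, ⟨w, -, hw⟩, hgf⟩ s ⟨x, hx, hxs⟩
    have hgs : g s = f x := hgf x s hxs
    have hwx : w 0 = f x := hw x 0 hx
    rw [hgs, ← hwx, map_zero]
  · intro hg
    obtain ⟨f, hgf⟩ := exists_mem_relAdj_of_vanishes_on_relMul0 hbdd
      fun y hy => hg y ⟨0, A.zero_mem, hy⟩
    obtain ⟨w, hw⟩ := exists_mem_relAdj_of_vanishes_on_relKer hA hRA (f := f) fun x hx => by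
      obtain ⟨z, hz⟩ : x ∈ relDom B := hdomB ▸ mem_univ x
      exact (hgf x z hz).symm.trans (hg z ⟨x, hx, hz⟩)
    exact ⟨f, ⟨w, mem_univ w, hw⟩, hgf⟩
end

section
/- Let X and Y be Banach spaces. Let A be a closed linear relation from X to Y with closed range R(A) and with finite nullity α(A), and let γ > 0 be a lower bound for A. Let B be a closed linear relation from X to Y with D(B) ⊇ D(A), B(0) ⊆ A(0), and suppose there is a constant C with 0 ≤ C < γ such that dist(z, B(0)) ≤ C·‖x‖ for every (x,z) ∈ G(B). Then the linear relation A + B is closed and has closed range, and moreover α(A + B) ≤ α(A) and β(A + B) ≤ β(A). -/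
open Metric Set

section Defs

variable {X Y : Type*} [AddCommGroup X] [Module ℂ X] [AddCommGroup Y] [Module ℂ Y]

/-- The range `R(A)` of a linear relation, as a submodule of `Y`. -/
def relRanS (A : Submodule ℂ (X × Y)) : Submodule ℂ Y := A.map (LinearMap.snd ℂ X Y)

/-- The null space `N(A)` of a linear relation, as a submodule of `X`. -/
def relKerS (A : Submodule ℂ (X × Y)) : Submodule ℂ X := A.comap (LinearMap.inl ℂ X Y)

/-- The sum `A + B` of two linear relations:
its graph is `{(x, y + z) : (x, y) ∈ G(A), (x, z) ∈ G(B)}`. -/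
def addRel (A B : Submodule ℂ (X × Y)) : Submodule ℂ (X × Y) where
  carrier := {p | ∃ y z, (p.1, y) ∈ A ∧ (p.1, z) ∈ B ∧ p.2 = y + z}
  add_mem' := by
    rintro ⟨x₁, w₁⟩ ⟨x₂, w₂⟩ ⟨y₁, z₁, hA₁, hB₁, rfl⟩ ⟨y₂, z₂, hA₂, hB₂, rfl⟩
    refine ⟨y₁ + y₂, z₁ + z₂, A.add_mem hA₁ hA₂, B.add_mem hB₁ hB₂, ?_⟩
    show (y₁ + z₁) + (y₂ + z₂) = (y₁ + y₂) + (z₁ + z₂)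
    abel
  zero_mem' := ⟨0, 0, A.zero_mem, B.zero_mem, (add_zero 0).symm⟩
  smul_mem' := by
    rintro c ⟨x, w⟩ ⟨y, z, hA, hB, rfl⟩
    refine ⟨c • y, c • z, A.smul_mem c hA, B.smul_mem c hB, ?_⟩
    show c • (y + z) = c • y + c • z
    exact smul_add c y z

end Defs

section Combinatorics

/-- Indicator (mod 2) that a list of signs alternates and starts with `b`. -/
def altInd : Bool → List Bool → ZMod 2
  | _, [] => 1
  | b, x :: l => if x = b then altInd (!b) l else 0

theorem erase_cons_of_sorted {x p : ℕ} {l : List ℕ} (h : (x :: l).Pairwise (· ≤ ·))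
    (hp : p ∈ l) : (x :: l).erase p = x :: l.erase p := by
  by_cases hpx : p = x
  · subst hpx
    cases l with
    | nil => simp at hp
    | cons y l' =>
      have h1 : p ≤ y := by
        have := List.pairwise_cons.1 h
        exact this.1 y (by simp)
      have h2 : y ≤ p := by
        rcases List.mem_cons.1 hp with h3 | h3
        · exact h3.ge
        · exact (List.pairwise_cons.1 (List.pairwise_cons.1 h).2).1 p h3
      have : y = p := le_antisymm h2 h1
      subst this
      simp
  · rw [List.erase_cons_tail]
    simpa using fun h => hpx h.symm

theorem sum_altInd_erase (b : Bool) (l : List ℕ) (hl : l.Pairwise (· ≤ ·)) (hne : l ≠ []) :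
    (l.map fun p => altInd b ((l.erase p).map Nat.bodd)).sum =
      altInd b (l.map Nat.bodd) + altInd (!b) (l.map Nat.bodd) := by
  induction l generalizing b with
  | nil => simp at hne
  | cons x l ih =>
    have key : (l.map fun p => altInd b (((x :: l).erase p).map Nat.bodd)) =
        l.map fun p => if x.bodd = b then altInd (!b) ((l.erase p).map Nat.bodd) else 0 := by
      refine List.map_congr_left fun p hp => ?_
      rw [erase_cons_of_sorted hl hp]
      simp [altInd]
    rw [List.map_cons, List.sum_cons, key, List.erase_cons_head]
    rcases eq_or_ne l [] with rfl | hl0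
    · simp only [List.map_nil, List.sum_nil, List.map_cons, altInd]
      cases b <;> cases x.bodd <;> simp
    · have h2 := fun b => ih b (List.pairwise_cons.1 hl).2 hl0
      have two : ∀ z : ZMod 2, z + z = 0 := by decide
      by_cases hx : x.bodd = b
      · simp only [hx, if_true, h2, List.map_cons, altInd, Bool.not_not]
        have : ¬ (b = !b) := by cases b <;> simp
        rw [if_neg this]
        linear_combination two (altInd b (l.map Nat.bodd))
      · have hx' : x.bodd = !b := by revert hx; cases b <;> cases x.bodd <;> simp
        have : ¬ ((!b) = b) := by cases b <;> simp
        simp [hx', this, altInd]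

theorem altInd_eq_zero {n : ℕ} (b : Bool) (l : List ℕ) (hl : l.Pairwise (· ≤ ·))
    (hgood : ∀ p ∈ l, ∀ q ∈ l, p / 2 = q / 2 → p = q) (k : ℕ)
    (hk : ∀ p ∈ l, k ≤ p / 2 ∧ p / 2 < n) (hlen : n < k + l.length) (hkn : k ≤ n) :
    altInd b (l.map Nat.bodd) = 0 := by
  induction l generalizing b k with
  | nil => simp at hlen; omega
  | cons x l ih =>
    simp only [List.map_cons, altInd]
    split_ifs with hx
    swap; · rfl
    have hkx := hk x (by simp)
    rw [List.pairwise_cons] at hl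
    cases l with
    | nil => simp at hlen; omega
    | cons y l' =>
      by_cases hy : y.bodd = !b
      · refine ih (!b) hl.2 (fun p hp q hq =>
          hgood p (List.mem_cons_of_mem _ hp) q (List.mem_cons_of_mem _ hq)) (k + 1) ?_
          (by simp at hlen ⊢; omega) (by omega)
        intro p hp
        refine ⟨?_, (hk p (List.mem_cons_of_mem _ hp)).2⟩
        have h1 : x ≤ y := hl.1 y (by simp)
        have h2 : y ≤ p := by
          rcases List.mem_cons.1 hp with h3 | h3
          · exact h3.ge
          · exact (List.pairwise_cons.1 hl.2).1 p h3
        have h3 : x / 2 ≠ y / 2 := by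
          intro h
          have := hgood x (by simp) y (by simp) h
          subst this
          rw [hx] at hy
          revert hy; cases b <;> simp
        omega
      · simp [altInd, hy]

/-- The label `p` with its sign reversed; labels `2 * i` and `2 * i + 1` are opposite. -/
def oppLabel (p : ℕ) : ℕ := if p.bodd then p - 1 else p + 1

theorem bodd_oppLabel (p : ℕ) : (oppLabel p).bodd = !p.bodd := by
  unfold oppLabel
  cases h : p.bodd
  · simp [h]
  · cases p with
    | zero => simp at h
    | succ p => simp at h; simp [h]

theorem oppLabel_bounds (p : ℕ) : 2 * (p / 2) ≤ oppLabel p ∧ oppLabel p ≤ 2 * (p / 2) + 1 := by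
  unfold oppLabel
  have h := Nat.mod_two_of_bodd p
  cases hb : p.bodd <;> rw [hb] at h <;> simp at h ⊢ <;> omega

theorem altInd_map_not (b : Bool) (l : List Bool) :
    altInd b (l.map not) = altInd (!b) l := by
  induction l generalizing b with
  | nil => rfl
  | cons x l ih =>
    simp only [List.map_cons, altInd, ih]
    cases b <;> cases x <;> simp

/-- Indicator (mod 2) that a multiset of labels, once sorted, alternates in sign starting at `b`. -/
def altLabel (b : Bool) (M : Multiset ℕ) : ZMod 2 := altInd b ((M.sort (· ≤ ·)).map Nat.bodd)

theorem sum_altLabel_erase (b : Bool) (M : Multiset ℕ) (hM : M ≠ 0) :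
    (M.map fun p => altLabel b (M.erase p)).sum = altLabel b M + altLabel (!b) M := by
  have hs : ((M.sort (· ≤ ·) : List ℕ) : Multiset ℕ) = M := Multiset.sort_eq _ _
  have hp : (M.sort (· ≤ ·)).Pairwise (· ≤ ·) := Multiset.pairwise_sort _ _
  have hne : M.sort (· ≤ ·) ≠ [] := by
    intro h; rw [h] at hs; exact hM hs.symm
  rw [altLabel, altLabel, ← sum_altInd_erase b _ hp hne]
  generalize M.sort (· ≤ ·) = l at hs hp
  subst hs
  rw [Multiset.map_coe, Multiset.sum_coe]
  congr 1
  refine List.map_congr_left fun p _ => ?_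
  rw [altLabel]
  congr 2
  rw [Multiset.coe_erase]
  refine List.Perm.eq_of_pairwise' (r := (· ≤ ·)) (Multiset.pairwise_sort _ _) (hp.sublist (List.erase_sublist)) ?_
  rw [← Multiset.coe_eq_coe, Multiset.sort_eq]

theorem altLabel_map_opp (b : Bool) (M : Multiset ℕ)
    (hgood : ∀ p ∈ M, ∀ q ∈ M, p / 2 = q / 2 → p = q) :
    altLabel b (M.map oppLabel) = altLabel (!b) M := by
  have : (M.map oppLabel).sort (· ≤ ·) = (M.sort (· ≤ ·)).map oppLabel := by
    symm
    apply Multiset.map_sort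
    intro p hp q hq
    have h1 := oppLabel_bounds p
    have h2 := oppLabel_bounds q
    have h3 := hgood p hp q hq
    by_cases h : p / 2 = q / 2
    · rw [h3 h]; simp
    · omega
  rw [altLabel, altLabel, this, ← altInd_map_not, List.map_map, List.map_map]
  congr 2
  funext p
  exact bodd_oppLabel p

theorem altLabel_eq_zero {n : ℕ} (b : Bool) (M : Multiset ℕ)
    (hgood : ∀ p ∈ M, ∀ q ∈ M, p / 2 = q / 2 → p = q) (hn : ∀ p ∈ M, p / 2 < n)
    (hcard : n < M.card) : altLabel b M = 0 := by
  refine altInd_eq_zero (n := n) b _ (Multiset.pairwise_sort _ _) ?_ 0 ?_ (by simpa) (by simp)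
  · simpa using hgood
  · simpa using hn

end Combinatorics

section Chains

open Classical in
/-- The mod 2 boundary of a simplex, given as the multiset of its vertices. -/
noncomputable def faces {E : Type*} (m : Multiset E) : Multiset E →₀ ZMod 2 :=
  (m.map fun x => Finsupp.single (m.erase x) 1).sum

/-- The augmented mod 2 simplicial boundary. -/
noncomputable def bdry {E : Type*} : (Multiset E →₀ ZMod 2) →ₗ[ZMod 2] (Multiset E →₀ ZMod 2) :=
  Finsupp.linearCombination (ZMod 2) faces

/-- The cone with apex `b`. -/
noncomputable def cone {E : Type*} (b : E) :
    (Multiset E →₀ ZMod 2) →ₗ[ZMod 2] (Multiset E →₀ ZMod 2) :=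
  Finsupp.lmapDomain (ZMod 2) (ZMod 2) (fun m => b ::ₘ m)

/-- The antipodal map on chains. -/
noncomputable def antip {E : Type*} [Neg E] :
    (Multiset E →₀ ZMod 2) →ₗ[ZMod 2] (Multiset E →₀ ZMod 2) :=
  Finsupp.lmapDomain (ZMod 2) (ZMod 2) (Multiset.map fun x => -x)

variable {E : Type*}

@[simp] theorem bdry_single (m : Multiset E) : bdry (Finsupp.single m 1) = faces m := by
  simp [bdry]

@[simp] theorem cone_single (b : E) (m : Multiset E) :
    cone b (Finsupp.single m 1) = Finsupp.single (b ::ₘ m) 1 := by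
  simp [cone]

@[simp] theorem antip_single [Neg E] (m : Multiset E) :
    antip (Finsupp.single m 1) = Finsupp.single (m.map fun x => -x) 1 := by
  simp [antip]

@[simp] theorem faces_zero : faces (0 : Multiset E) = 0 := by simp [faces]

theorem faces_cons (b : E) (m : Multiset E) :
    faces (b ::ₘ m) = Finsupp.single m 1 + cone b (faces m) := by
  classical
  simp only [faces, Multiset.map_cons, Multiset.sum_cons, map_multiset_sum, Multiset.map_map,
    Function.comp_def, cone_single]
  congr 1
  · congr 1; convert Multiset.erase_cons_head b m
  · congr 1
    refine Multiset.map_congr rfl fun x hx => ?_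
    congr 1
    by_cases h : b = x
    · subst h; rw [Multiset.erase_cons_head, Multiset.cons_erase hx]
    · rw [Multiset.erase_cons_tail _ h]

theorem chain_add_self (c : Multiset E →₀ ZMod 2) : c + c = 0 := by
  ext m
  have two : ∀ z : ZMod 2, z + z = 0 := by decide
  exact two _

theorem bdry_cone (b : E) (c : Multiset E →₀ ZMod 2) : bdry (cone b c) = c + cone b (bdry c) := by
  suffices h : bdry ∘ₗ cone b = LinearMap.id + cone b ∘ₗ bdry from LinearMap.congr_fun h c
  refine Finsupp.lhom_ext' fun m => LinearMap.ext_ring ?_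
  simp [faces_cons]

theorem bdry_bdry (c : Multiset E →₀ ZMod 2) : bdry (bdry c) = 0 := by
  suffices h : (bdry : (Multiset E →₀ ZMod 2) →ₗ[ZMod 2] _) ∘ₗ bdry = 0 from LinearMap.congr_fun h c
  refine Finsupp.lhom_ext' fun m => LinearMap.ext_ring ?_
  simp only [LinearMap.comp_apply, Finsupp.lsingle_apply, bdry_single, LinearMap.zero_apply]
  induction m using Multiset.induction with
  | empty => simp
  | cons b m ih =>
    rw [faces_cons, map_add, bdry_single, bdry_cone, ih, map_zero, add_zero, chain_add_self]

theorem antip_cone [Neg E] (b : E) (c : Multiset E →₀ ZMod 2) :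
    antip (cone b c) = cone (-b) (antip c) := by
  suffices h : antip ∘ₗ cone b = cone (-b) ∘ₗ antip from LinearMap.congr_fun h c
  refine Finsupp.lhom_ext' fun m => LinearMap.ext_ring ?_
  simp

theorem antip_antip [InvolutiveNeg E] (c : Multiset E →₀ ZMod 2) : antip (antip c) = c := by
  suffices h : (antip : (Multiset E →₀ ZMod 2) →ₗ[ZMod 2] _) ∘ₗ antip = LinearMap.id from
    LinearMap.congr_fun h c
  refine Finsupp.lhom_ext' fun m => LinearMap.ext_ring ?_
  simp

theorem bdry_antip [Neg E] (c : Multiset E →₀ ZMod 2) : bdry (antip c) = antip (bdry c) := by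
  suffices h : bdry ∘ₗ antip = antip ∘ₗ bdry (E := E) from LinearMap.congr_fun h c
  refine Finsupp.lhom_ext' fun m => LinearMap.ext_ring ?_
  simp only [LinearMap.comp_apply, Finsupp.lsingle_apply, bdry_single, antip_single]
  induction m using Multiset.induction with
  | empty => simp
  | cons b m ih => rw [Multiset.map_cons, faces_cons, ih, faces_cons, map_add, antip_single, antip_cone]

/-- A linear identity on chains of faces follows from the identity on each face. -/
theorem faces_induction {P : (Multiset E →₀ ZMod 2) → Prop} (h0 : P 0)
    (hadd : ∀ a b, P a → P b → P (a + b)) (m : Multiset E)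
    (h : ∀ m' : Multiset E, m' < m → P (Finsupp.single m' 1)) : P (faces m) := by
  classical
  rw [faces]
  refine Multiset.sum_induction P _ hadd h0 fun c hc => ?_
  obtain ⟨x, hx, rfl⟩ := Multiset.mem_map.1 hc
  exact h _ (Multiset.erase_lt.2 hx)

/-- A linear map sending simplices in `S` to chains supported in `S'` sends chains supported in `S`
to chains supported in `S'`. -/
theorem map_mem_supported {S S' : Set (Multiset E)}
    (F : (Multiset E →₀ ZMod 2) →ₗ[ZMod 2] (Multiset E →₀ ZMod 2))
    (hF : ∀ m ∈ S, F (Finsupp.single m 1) ∈ Finsupp.supported (ZMod 2) (ZMod 2) S')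
    {c : Multiset E →₀ ZMod 2} (hc : c ∈ Finsupp.supported (ZMod 2) (ZMod 2) S) :
    F c ∈ Finsupp.supported (ZMod 2) (ZMod 2) S' := by
  rw [Finsupp.supported_eq_span_single] at hc
  have : Submodule.span (ZMod 2) ((fun i => Finsupp.single i (1 : ZMod 2)) '' S) ≤
      (Finsupp.supported (ZMod 2) (ZMod 2) S').comap F := by
    rw [Submodule.span_le]
    rintro _ ⟨m, hm, rfl⟩
    exact hF m hm
  exact this hc

theorem faces_mem_supported {m : Multiset E} {S : Set (Multiset E)}
    (h : ∀ x m', m = x ::ₘ m' → m' ∈ S) :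
    faces m ∈ Finsupp.supported (ZMod 2) (ZMod 2) S := by
  classical
  rw [faces]
  refine Multiset.sum_induction (fun c => c ∈ Finsupp.supported (ZMod 2) (ZMod 2) S) _
    (fun a b => Submodule.add_mem _) (Submodule.zero_mem _) fun c hc => ?_
  obtain ⟨x, hx, rfl⟩ := Multiset.mem_map.1 hc
  exact Finsupp.single_mem_supported _ _ (h x _ (Multiset.cons_erase hx).symm)

theorem cone_mem_supported {b : E} {S S' : Set (Multiset E)} (h : ∀ m ∈ S, b ::ₘ m ∈ S')
    {c : Multiset E →₀ ZMod 2} (hc : c ∈ Finsupp.supported (ZMod 2) (ZMod 2) S) :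
    cone b c ∈ Finsupp.supported (ZMod 2) (ZMod 2) S' :=
  map_mem_supported _ (fun m hm => by
    rw [cone_single]; exact Finsupp.single_mem_supported _ _ (h m hm)) hc

variable [AddCommGroup E] [Module ℝ E]

/-- The barycentre of a multiset of points. -/
noncomputable def bary (m : Multiset E) : E := (m.card : ℝ)⁻¹ • m.sum

open Classical in
/-- Barycentric subdivision of a simplex. -/
noncomputable def sdSimplex (m : Multiset E) : Multiset E →₀ ZMod 2 :=
  if m = 0 then Finsupp.single 0 1
  else cone (bary m) (m.attach.map fun x => sdSimplex (m.erase x.1)).sum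
termination_by m.card
decreasing_by exact Multiset.card_erase_lt_of_mem x.2

/-- Barycentric subdivision of chains. -/
noncomputable def sd : (Multiset E →₀ ZMod 2) →ₗ[ZMod 2] (Multiset E →₀ ZMod 2) :=
  Finsupp.linearCombination (ZMod 2) sdSimplex

@[simp] theorem sd_single (m : Multiset E) : sd (Finsupp.single m 1) = sdSimplex m := by
  simp [sd]

theorem sdSimplex_zero : sdSimplex (0 : Multiset E) = Finsupp.single 0 1 := by
  rw [sdSimplex]; simp

theorem sdSimplex_of_ne {m : Multiset E} (hm : m ≠ 0) :
    sdSimplex m = cone (bary m) (sd (faces m)) := by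
  classical
  rw [sdSimplex, if_neg hm]
  congr 1
  simp only [faces, map_multiset_sum, Multiset.map_map, Function.comp_def, sd_single]
  congr 1
  conv_rhs => rw [← Multiset.attach_map_val m, Multiset.map_map]
  simp only [Function.comp_def, Multiset.attach_map_val]

theorem bdry_sd (c : Multiset E →₀ ZMod 2) : bdry (sd c) = sd (bdry c) := by
  suffices h : bdry ∘ₗ sd = sd ∘ₗ bdry (E := E) from LinearMap.congr_fun h c
  refine Finsupp.lhom_ext' fun m => LinearMap.ext_ring ?_
  simp only [LinearMap.comp_apply, Finsupp.lsingle_apply]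
  induction m using Multiset.strongInductionOn with
  | _ m ih =>
    rcases eq_or_ne m 0 with rfl | hm
    · simp [sdSimplex_zero]
    · rw [sd_single, sdSimplex_of_ne hm, bdry_cone, bdry_single]
      have : bdry (sd (faces m)) = sd (bdry (faces m)) := by
        refine faces_induction (P := fun c => bdry (sd c) = sd (bdry c)) (by simp) ?_ m ih
        intro a b ha hb
        simp [ha, hb]
      rw [this, ← bdry_single, bdry_bdry]
      simp

theorem antip_sd (c : Multiset E →₀ ZMod 2) : antip (sd c) = sd (antip c) := by
  suffices h : antip ∘ₗ sd = sd ∘ₗ antip (E := E) from LinearMap.congr_fun h c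
  refine Finsupp.lhom_ext' fun m => LinearMap.ext_ring ?_
  simp only [LinearMap.comp_apply, Finsupp.lsingle_apply]
  induction m using Multiset.strongInductionOn with
  | _ m ih =>
    rcases eq_or_ne m 0 with rfl | hm
    · simp [sdSimplex_zero]
    · have h1 : antip (sd (faces m)) = sd (antip (faces m)) := by
        refine faces_induction (P := fun c => antip (sd c) = sd (antip c)) (by simp) ?_ m ih
        intro a b ha hb
        simp [ha, hb]
      have hb : bary (m.map fun x => -x) = -bary m := by
        simp [bary, Multiset.sum_map_neg']
      rw [antip_single, sd_single, sd_single, sdSimplex_of_ne hm, sdSimplex_of_ne (by simpa), antip_cone,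
        h1, hb, ← bdry_single, ← bdry_single, ← antip_single, bdry_antip]

end Chains

section Mesh

variable {E : Type*} [NormedAddCommGroup E] [NormedSpace ℝ E]

theorem bary_mem {C : Set E} (hC : Convex ℝ C) {m : Multiset E} (hm : m ≠ 0)
    (h : ∀ x ∈ m, x ∈ C) : bary m ∈ C := by
  induction m using Multiset.induction with
  | empty => exact absurd rfl hm
  | cons x m ih =>
    rcases eq_or_ne m 0 with rfl | hm0
    · simpa [bary] using h x (by simp)
    · have h1 := ih hm0 fun y hy => h y (Multiset.mem_cons_of_mem hy)
      have hk : (0 : ℝ) < m.card := by exact_mod_cast Multiset.card_pos.2 hm0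
      have : bary (x ::ₘ m) = ((m.card : ℝ) + 1)⁻¹ • x + ((m.card : ℝ) + 1)⁻¹ • (m.card : ℝ) • bary m := by
        simp [bary, smul_smul, hk.ne']
      rw [this, smul_smul]
      refine hC (h x (by simp)) h1 (by positivity) (by positivity) ?_
      field_simp
      ring

theorem norm_sub_bary_le {m : Multiset E} {v : E} (hv : v ∈ m) {D : ℝ}
    (hD : ∀ x ∈ m, ∀ y ∈ m, ‖x - y‖ ≤ D) {K : ℕ} (hK : m.card ≤ K + 1) :
    ‖v - bary m‖ ≤ K / (K + 1) * D := by
  obtain ⟨m', rfl⟩ := Multiset.exists_cons_of_mem hv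
  have hD0 : 0 ≤ D := (norm_nonneg _).trans (hD v hv v hv)
  have h1 : v - bary (v ::ₘ m') = ((m'.card : ℝ) + 1)⁻¹ • (m'.map fun u => v - u).sum := by
    have h2 : (m'.map fun u => v - u).sum = (m'.card : ℝ) • v - m'.sum := by
      rw [Multiset.sum_map_sub]; simp [Nat.cast_smul_eq_nsmul]
    have h3 : ((m'.card : ℝ) + 1) ≠ 0 := by positivity
    rw [h2]
    simp only [bary, Multiset.card_cons, Multiset.sum_cons, Nat.cast_add, Nat.cast_one]
    rw [eq_inv_smul_iff₀ h3, smul_sub, smul_smul, mul_inv_cancel₀ h3]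
    module
  have h2 : ‖(m'.map fun u => v - u).sum‖ ≤ m'.card * D := by
    have : (m'.map fun u => ‖v - u‖).sum ≤ (m'.map fun u => ‖v - u‖).card • D := by
      refine Multiset.sum_le_card_nsmul _ _ fun a ha => ?_
      obtain ⟨u, hu, rfl⟩ := Multiset.mem_map.1 ha
      exact hD v hv u (Multiset.mem_cons_of_mem hu)
    refine (norm_multiset_sum_le _).trans ?_
    simpa [Multiset.map_map] using this
  have hk : (m'.card : ℝ) ≤ K := by
    have : m'.card ≤ K := by simpa using hK
    exact_mod_cast this
  rw [h1, norm_smul, norm_inv, Real.norm_of_nonneg (by positivity)]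
  calc _ ≤ ((m'.card : ℝ) + 1)⁻¹ * (m'.card * D) := by gcongr
    _ = (1 - ((m'.card : ℝ) + 1)⁻¹) * D := by field_simp; ring
    _ ≤ (1 - ((K : ℝ) + 1)⁻¹) * D := by gcongr
    _ = _ := by field_simp; ring

/-- Simplices with `k` vertices in `C` and of diameter at most `D`. -/
def smallSimplices (k : ℕ) (D : ℝ) (C : Set E) : Set (Multiset E) :=
  {m | m.card = k ∧ (∀ x ∈ m, x ∈ C) ∧ ∀ x ∈ m, ∀ y ∈ m, ‖x - y‖ ≤ D}

theorem sdSimplex_mem_supported {K k : ℕ} {D : ℝ} (hD : 0 ≤ D) {C : Set E} (hC : Convex ℝ C)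
    (hk : k ≤ K + 1) {m : Multiset E} (hm : m ∈ smallSimplices k D C) :
    sdSimplex m ∈ Finsupp.supported (ZMod 2) (ZMod 2) (smallSimplices k (K / (K + 1) * D) C) := by
  induction k generalizing m C with
  | zero =>
    have : m = 0 := Multiset.card_eq_zero.1 hm.1
    subst this
    rw [sdSimplex_zero]
    exact Finsupp.single_mem_supported _ _ (by simp [smallSimplices])
  | succ k ih =>
    have hm0 : m ≠ 0 := by
      intro h; have := hm.1; simp [h] at this
    rw [sdSimplex_of_ne hm0]
    set r : ℝ := K / (K + 1) * D
    have hr : 0 ≤ r := by positivity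
    have hC' : Convex ℝ (C ∩ closedBall (bary m) r) := hC.inter (convex_closedBall _ _)
    have hb := bary_mem hC hm0 hm.2.1
    have hmC : ∀ x ∈ m, x ∈ C ∩ closedBall (bary m) r := fun x hx =>
      ⟨hm.2.1 x hx, by
        rw [mem_closedBall, dist_eq_norm]
        exact norm_sub_bary_le hx hm.2.2 (hm.1.le.trans hk)⟩
    refine cone_mem_supported (S := smallSimplices k r (C ∩ closedBall (bary m) r)) ?_
      (map_mem_supported (S := smallSimplices k D (C ∩ closedBall (bary m) r)) sd
        (fun m' hm' => by
          rw [sd_single]; exact ih hC' (by omega) hm') (faces_mem_supported ?_))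
    · intro m' hm'
      refine ⟨by simp [hm'.1], ?_, ?_⟩
      · intro x hx
        rcases Multiset.mem_cons.1 hx with rfl | hx
        · exact hb
        · exact (hm'.2.1 x hx).1
      · intro x hx y hy
        have key : ∀ z ∈ m', ‖z - bary m‖ ≤ r := fun z hz => by
          have := (hm'.2.1 z hz).2
          rwa [mem_closedBall, dist_eq_norm] at this
        rcases Multiset.mem_cons.1 hx with rfl | hx <;> rcases Multiset.mem_cons.1 hy with rfl | hy
        · simpa using hr
        · rw [norm_sub_rev]; exact key y hy
        · exact key x hx
        · exact hm'.2.2 x hx y hy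
    · rintro x m' rfl
      have h1 := hm.1
      rw [Multiset.card_cons] at h1
      exact ⟨by omega, fun y hy => hmC y (Multiset.mem_cons_of_mem hy), fun y hy z hz =>
        hm.2.2 y (Multiset.mem_cons_of_mem hy) z (Multiset.mem_cons_of_mem hz)⟩

end Mesh

section Borsuk

/-- The mod 2 number of simplices of a chain whose labels alternate, starting with the sign `b`. -/
noncomputable def altCount {E : Type*} (lam : E → ℕ) (b : Bool) :
    (Multiset E →₀ ZMod 2) →ₗ[ZMod 2] ZMod 2 :=
  Finsupp.linearCombination (ZMod 2) fun m => altLabel b (m.map lam)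

theorem altCount_single {E : Type*} (lam : E → ℕ) (b : Bool) (m : Multiset E) :
    altCount lam b (Finsupp.single m 1) = altLabel b (m.map lam) := by
  simp [altCount]

theorem altCount_faces {E : Type*} (lam : E → ℕ) (b : Bool) {m : Multiset E} (hm : m ≠ 0) :
    altCount lam b (faces m) = altLabel b (m.map lam) + altLabel (!b) (m.map lam) := by
  classical
  rw [← sum_altLabel_erase b _ (by simpa), faces, map_multiset_sum, Multiset.map_map,
    Multiset.map_map]
  congr 1
  refine Multiset.map_congr rfl fun x hx => ?_
  rw [Function.comp_apply, altCount_single, Multiset.map_erase_of_mem _ _ hx]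
  rfl

/-- Two linear maps agreeing on the simplices in `S` agree on chains supported in `S`. -/
theorem eq_of_mem_supported {E M : Type*} [AddCommGroup M] [Module (ZMod 2) M]
    {S : Set (Multiset E)} {F G : (Multiset E →₀ ZMod 2) →ₗ[ZMod 2] M}
    (h : ∀ m ∈ S, F (Finsupp.single m 1) = G (Finsupp.single m 1)) {c : Multiset E →₀ ZMod 2}
    (hc : c ∈ Finsupp.supported (ZMod 2) (ZMod 2) S) : F c = G c := by
  rw [Finsupp.supported_eq_span_single] at hc
  refine LinearMap.eqOn_span (s := (fun i => Finsupp.single i (1 : ZMod 2)) '' S) ?_ hc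
  rintro _ ⟨m, hm, rfl⟩
  exact h m hm

/-- Ky Fan's combinatorial lemma (mod 2): an antipodal labelling with `n` pairs of opposite labels
of an antipodal system of chains of dimension `n` has a complementary edge. -/
theorem false_of_antipodal_labelling {E : Type*} [Neg E] (lam : E → ℕ) (n : ℕ)
    (c : ℕ → Multiset E →₀ ZMod 2) (S : ℕ → Set (Multiset E))
    (hS : ∀ d ≤ n, c d ∈ Finsupp.supported (ZMod 2) (ZMod 2) (S d))
    (hcard : ∀ d ≤ n, ∀ m ∈ S d, m.card = d + 1)
    (hgood : ∀ d ≤ n, ∀ m ∈ S d, ∀ x ∈ m, ∀ y ∈ m, lam x / 2 = lam y / 2 → lam x = lam y)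
    (hlt : ∀ d ≤ n, ∀ m ∈ S d, ∀ x ∈ m, lam x / 2 < n)
    (hopp : ∀ d ≤ n, ∀ m ∈ S d, ∀ x ∈ m, lam (-x) = oppLabel (lam x))
    (h0 : bdry (c 0) = Finsupp.single 0 1)
    (hstep : ∀ d < n, bdry (c (d + 1)) = c d + antip (c d)) : False := by
  have hbd : ∀ d ≤ n, altCount lam true (bdry (c d)) =
      altCount lam true (c d) + altCount lam false (c d) := by
    intro d hd
    refine eq_of_mem_supported (F := altCount lam true ∘ₗ bdry)
      (G := altCount lam true + altCount lam false) (fun m hm => ?_) (hS d hd)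
    have hm0 : m ≠ 0 := by
      intro h; have := hcard d hd m hm; simp [h] at this
    simp [altCount_faces lam true hm0, altCount_single]
  have hanti : ∀ d ≤ n, altCount lam true (antip (c d)) = altCount lam false (c d) := by
    intro d hd
    refine eq_of_mem_supported (F := altCount lam true ∘ₗ antip)
      (G := altCount lam false) (fun m hm => ?_) (hS d hd)
    rw [LinearMap.comp_apply, antip_single, altCount_single, altCount_single, Multiset.map_map]
    have : Multiset.map (lam ∘ fun x => -x) m = (m.map lam).map oppLabel := by
      rw [Multiset.map_map]
      exact Multiset.map_congr rfl fun x hx => hopp d hd m hm x hx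
    rw [this, altLabel_map_opp]
    · rfl
    · intro p hp q hq
      obtain ⟨x, hx, rfl⟩ := Multiset.mem_map.1 hp
      obtain ⟨y, hy, rfl⟩ := Multiset.mem_map.1 hq
      exact hgood d hd m hm x hx y hy
  have hone : ∀ d ≤ n, altCount lam true (c d) + altCount lam false (c d) = 1 := by
    intro d
    induction d with
    | zero =>
      intro hd
      rw [← hbd 0 hd, h0, altCount_single]
      simp [altLabel, altInd]
    | succ d ih =>
      intro hd
      rw [← hbd _ hd, hstep d (by omega), map_add, hanti d (by omega), ih (by omega)]
  have hzero : ∀ b, altCount lam b (c n) = 0 := by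
    intro b
    refine eq_of_mem_supported (F := altCount lam b) (G := 0) (fun m hm => ?_) (hS n le_rfl)
    rw [altCount_single, LinearMap.zero_apply]
    refine altLabel_eq_zero (n := n) b _ ?_ ?_ (by simp [hcard n le_rfl m hm])
    · intro p hp q hq
      obtain ⟨x, hx, rfl⟩ := Multiset.mem_map.1 hp
      obtain ⟨y, hy, rfl⟩ := Multiset.mem_map.1 hq
      exact hgood n le_rfl m hm x hx y hy
    · intro p hp
      obtain ⟨x, hx, rfl⟩ := Multiset.mem_map.1 hp
      exact hlt n le_rfl m hm x hx
  have := hone n le_rfl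
  simp [hzero] at this

/-- Upper hemispheres of the boundary of the cross-polytope with vertices `± e i`. -/
noncomputable def octChain {E : Type*} [Neg E] (e : ℕ → E) : ℕ → Multiset E →₀ ZMod 2
  | 0 => cone (e 0) (Finsupp.single 0 1)
  | d + 1 => cone (e (d + 1)) (octChain e d + antip (octChain e d))

theorem bdry_octChain_zero {E : Type*} [Neg E] (e : ℕ → E) :
    bdry (octChain e 0) = Finsupp.single 0 1 := by
  rw [octChain, bdry_cone]; simp

theorem bdry_octChain_succ {E : Type*} [InvolutiveNeg E] (e : ℕ → E) (d : ℕ) :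
    bdry (octChain e (d + 1)) = octChain e d + antip (octChain e d) := by
  have key : bdry (octChain e d + antip (octChain e d)) = 0 := by
    rw [map_add, bdry_antip]
    cases d with
    | zero => rw [bdry_octChain_zero]; simp [chain_add_self]
    | succ d =>
      rw [bdry_octChain_succ e d, map_add, antip_antip, add_comm (antip _), chain_add_self]
  rw [octChain, bdry_cone, key, map_zero, add_zero]

theorem octChain_mem_supported {E : Type*} [AddCommGroup E] [Module ℝ E] (e : ℕ → E) (d : ℕ) :
    octChain e d ∈ Finsupp.supported (ZMod 2) (ZMod 2)
      {m | m.card = d + 1 ∧ ∃ s : ℕ → ℝ, (∀ i, s i = 1 ∨ s i = -1) ∧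
        ∀ x ∈ m, ∃ i ≤ d, x = s i • e i} := by
  induction d with
  | zero =>
    rw [octChain, cone_single]
    refine Finsupp.single_mem_supported _ _ ⟨by simp, fun _ => 1, by simp, ?_⟩
    intro x hx
    refine ⟨0, le_rfl, ?_⟩
    simpa using hx
  | succ d ih =>
    rw [octChain]
    refine cone_mem_supported ?_ (Submodule.add_mem _ ih (map_mem_supported antip ?_ ih))
    · rintro m ⟨hm, s, hs, hx⟩
      refine ⟨by simp [hm], Function.update s (d + 1) 1, ?_, ?_⟩
      · intro i
        by_cases hi : i = d + 1
        · subst hi; simp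
        · simpa [hi] using hs i
      · intro x hxm
        rcases Multiset.mem_cons.1 hxm with rfl | hxm
        · exact ⟨d + 1, le_rfl, by simp⟩
        · obtain ⟨i, hi, rfl⟩ := hx x hxm
          have hid : i ≠ d + 1 := by omega
          exact ⟨i, by omega, by simp [hid]⟩
    · rintro m ⟨hm, s, hs, hx⟩
      rw [antip_single]
      refine Finsupp.single_mem_supported _ _ ⟨by simp [hm], fun i => -s i, ?_, ?_⟩
      · intro i
        rcases hs i with h | h <;> simp [h]
      · intro x hxm
        obtain ⟨y, hy, rfl⟩ := Multiset.mem_map.1 hxm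
        obtain ⟨i, hi, rfl⟩ := hx y hy
        exact ⟨i, hi, by simp⟩

/-- The facet of the cross-polytope in `ℝ^N` with sign vector `s`, thickened to a convex set
of points of norm at most one which does not contain the origin. -/
def signCell (N : ℕ) (s : ℕ → ℝ) : Set (Fin N → ℝ) := {x | ‖x‖ ≤ 1 ∧ 1 ≤ ∑ j : Fin N, s j * x j}

theorem convex_signCell (N : ℕ) (s : ℕ → ℝ) : Convex ℝ (signCell N s) := by
  have h1 : signCell N s = closedBall 0 1 ∩ {x | 1 ≤ ∑ j : Fin N, s j * x j} := by
    ext x; simp [signCell]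
  rw [h1]
  refine (convex_closedBall _ _).inter ?_
  refine convex_halfSpace_ge (f := fun x : Fin N → ℝ => ∑ j : Fin N, s j * x j) ⟨?_, ?_⟩ 1
  · intro x y; simp [mul_add, Finset.sum_add_distrib]
  · intro c x; simp [Finset.mul_sum, mul_left_comm]

section

variable {E : Type*} [AddCommGroup E] [Module ℝ E]

theorem bdry_sd_pow (k : ℕ) (c : Multiset E →₀ ZMod 2) :
    bdry ((sd ^ k) c) = (sd ^ k) (bdry c) := by
  induction k with
  | zero => rfl
  | succ k ih => rw [pow_succ', Module.End.mul_apply, Module.End.mul_apply, bdry_sd, ih]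

theorem antip_sd_pow (k : ℕ) (c : Multiset E →₀ ZMod 2) :
    antip ((sd ^ k) c) = (sd ^ k) (antip c) := by
  induction k with
  | zero => rfl
  | succ k ih => rw [pow_succ', Module.End.mul_apply, Module.End.mul_apply, antip_sd, ih]

theorem sd_pow_single_zero (k : ℕ) :
    (sd ^ k) (Finsupp.single (0 : Multiset E) 1) = Finsupp.single 0 1 := by
  induction k with
  | zero => rfl
  | succ k ih => rw [pow_succ', Module.End.mul_apply, ih, sd_single, sdSimplex_zero]

end

/-- The **Borsuk–Ulam theorem**, for odd maps on punctured Euclidean space. -/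
theorem exists_zero_of_odd {n : ℕ} (f : (Fin (n + 1) → ℝ) → (Fin n → ℝ))
    (hf : ContinuousOn f {0}ᶜ) (hodd : ∀ x, x ≠ 0 → f (-x) = -f x) : ∃ x, x ≠ 0 ∧ f x = 0 := by
  by_contra! hne
  set K : Set (Fin (n + 1) → ℝ) := {x | ‖x‖ ≤ 1 ∧ 1 ≤ ∑ j, |x j|} with hKdef
  have hK0 : ∀ x ∈ K, x ≠ 0 := by
    rintro x hx rfl
    have := hx.2
    simp at this
    linarith
  have hKc : IsCompact K := by
    have : K = closedBall 0 1 ∩ {x | 1 ≤ ∑ j, |x j|} := by ext x; simp [K]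
    rw [this]
    exact (isCompact_closedBall _ _).inter_right (isClosed_le (by fun_prop) (by fun_prop))
  have hfK : ContinuousOn f K := hf.mono fun x hx => hK0 x hx
  obtain ⟨ε, hε, hεK⟩ := hKc.exists_forall_le' (a := 0) hfK.norm
    (fun x hx => norm_pos_iff.2 (hne x (hK0 x hx)))
  have hex : ∀ x ∈ K, ∃ i, ε ≤ |f x i| := by
    intro x hx
    by_contra! h
    have : ‖f x‖ < ε := (pi_norm_lt_iff hε).2 h
    exact absurd (hεK x hx) (not_le.2 this)
  obtain ⟨δ, hδ, hδK⟩ := Metric.uniformContinuousOn_iff.1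
    (hKc.uniformContinuousOn_of_continuous hfK) ε hε
  rcases Nat.eq_zero_or_pos n with rfl | hn
  · have hmem : (fun _ => 1 : Fin (0 + 1) → ℝ) ∈ K :=
      ⟨by rw [pi_norm_le_iff_of_nonneg] <;> simp, by simp⟩
    obtain ⟨i, -⟩ := hex _ hmem
    exact i.elim0
  have : Nonempty (Fin n) := ⟨⟨0, hn⟩⟩
  let I : (Fin (n + 1) → ℝ) → Fin n := fun x => Classical.epsilon fun i => ε ≤ |f x i|
  have hI : ∀ x ∈ K, ε ≤ |f x (I x)| := fun x hx => Classical.epsilon_spec (hex x hx)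
  have hIneg : ∀ x ∈ K, I (-x) = I x := by
    intro x hx
    simp only [I, hodd x (hK0 x hx), Pi.neg_apply, abs_neg]
  let lam : (Fin (n + 1) → ℝ) → ℕ := fun x => 2 * I x + if 0 < f x (I x) then 1 else 0
  have hlam2 : ∀ x, lam x / 2 = I x := by
    intro x
    simp only [lam]
    split_ifs <;> omega
  have hlamopp : ∀ x ∈ K, lam (-x) = oppLabel (lam x) := by
    intro x hx
    have h1 := hI x hx
    simp only [lam, hIneg x hx, hodd x (hK0 x hx), Pi.neg_apply, oppLabel]
    by_cases h : 0 < f x (I x)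
    · have h2 : ¬ 0 < -f x (I x) := by linarith
      simp [h, h2]
    · have h2 : 0 < -f x (I x) := by
        rcases (not_lt.1 h).lt_or_eq with h3 | h3
        · linarith
        · rw [h3] at h1; simp at h1; linarith
      have h4 : f x (I x) < 0 := by linarith
      simp [h, h4]
  have hlamgood : ∀ x ∈ K, ∀ y ∈ K, ‖x - y‖ < δ → lam x / 2 = lam y / 2 → lam x = lam y := by
    intro x hx y hy hxy h
    rw [hlam2, hlam2] at h
    have h : I x = I y := Fin.ext h
    have h1 := hI x hx
    have h2 := hI y hy
    have h3 := hδK x hx y hy (by rwa [dist_eq_norm])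
    have h4 : |f x (I x) - f y (I x)| < ε := by
      rw [dist_eq_norm] at h3
      exact (norm_le_pi_norm (f x - f y) (I x)).trans_lt h3
    rw [← h] at h2
    simp only [lam, ← h]
    congr 1
    rw [abs_lt] at h4
    rcases le_abs'.1 h1 with h5 | h5 <;> rcases le_abs'.1 h2 with h6 | h6
    · rw [if_neg (by linarith), if_neg (by linarith)]
    · linarith
    · linarith
    · rw [if_pos (by linarith), if_pos (by linarith)]
  let e : ℕ → (Fin (n + 1) → ℝ) := fun i j => if (j : ℕ) = i then 1 else 0
  set r : ℝ := n / (n + 1)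
  have hr0 : 0 ≤ r := by positivity
  have hr1 : r < 1 := by rw [div_lt_one (by positivity)]; linarith
  have hsub : ∀ s : ℕ → ℝ, (∀ i, s i = 1 ∨ s i = -1) → signCell (n + 1) s ⊆ K := by
    intro s hs x hx
    refine ⟨hx.1, hx.2.trans (Finset.sum_le_sum fun j _ => ?_)⟩
    rcases hs j with h | h <;> rw [h]
    · simpa using le_abs_self _
    · simpa using neg_le_abs _
  have hsupp : ∀ k : ℕ, ∀ d ≤ n, (sd ^ k) (octChain e d) ∈ Finsupp.supported (ZMod 2) (ZMod 2)
      {m | ∃ s : ℕ → ℝ, (∀ i, s i = 1 ∨ s i = -1) ∧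
        m ∈ smallSimplices (d + 1) (r ^ k * 2) (signCell (n + 1) s)} := by
    intro k d hd
    induction k with
    | zero =>
      refine Finsupp.supported_mono ?_ (octChain_mem_supported e d)
      rintro m ⟨hm, s, hs, hx⟩
      have hball : ∀ x ∈ m, x ∈ signCell (n + 1) s := by
        intro x hxm
        obtain ⟨i, hi, rfl⟩ := hx x hxm
        have hsi : |s i| = 1 := by rcases hs i with h | h <;> simp [h]
        have hss : s i * s i = 1 := by rcases hs i with h | h <;> simp [h]
        refine ⟨?_, ?_⟩
        · rw [norm_smul, Real.norm_eq_abs, hsi, one_mul, pi_norm_le_iff_of_nonneg zero_le_one]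
          intro j
          simp only [e]
          split_ifs <;> simp
        · refine le_of_eq ?_
          rw [Finset.sum_eq_single (⟨i, by omega⟩ : Fin (n + 1))]
          · simp [e, hss]
          · intro j _ hj
            have : (j : ℕ) ≠ i := fun h => hj (Fin.ext h)
            simp [e, this]
          · simp
      refine ⟨s, hs, hm, hball, fun x hx y hy => ?_⟩
      have := norm_sub_le x y
      have h1 := (hball x hx).1
      have h2 := (hball y hy).1
      simp
      linarith
    | succ k ih =>
      rw [pow_succ' sd, Module.End.mul_apply]
      refine map_mem_supported sd ?_ ih
      rintro m ⟨s, hs, hm⟩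
      rw [sd_single]
      refine Finsupp.supported_mono ?_ (sdSimplex_mem_supported (K := n) (by positivity)
        (convex_signCell _ s) (by omega) hm)
      intro m' hm'
      refine ⟨s, hs, ?_⟩
      rwa [pow_succ', mul_assoc]
  obtain ⟨k, hk⟩ := exists_pow_lt_of_lt_one (show 0 < δ / 2 by positivity) hr1
  have hk : r ^ k * 2 < δ := by linarith
  refine false_of_antipodal_labelling lam n (fun d => (sd ^ k) (octChain e d)) _
    (fun d hd => hsupp k d hd) ?_ ?_ ?_ ?_ ?_ ?_
  · rintro d - m ⟨s, hs, hm⟩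
    exact hm.1
  · rintro d - m ⟨s, hs, hm⟩ x hx y hy
    exact hlamgood x (hsub s hs (hm.2.1 x hx)) y (hsub s hs (hm.2.1 y hy))
      ((hm.2.2 x hx y hy).trans_lt hk)
  · rintro d - m ⟨s, hs, hm⟩ x hx
    rw [hlam2]; exact (I x).2
  · rintro d - m ⟨s, hs, hm⟩ x hx
    exact hlamopp x (hsub s hs (hm.2.1 x hx))
  · simp only [bdry_sd_pow, bdry_octChain_zero, sd_pow_single_zero]
  · intro d _
    simp only [bdry_sd_pow, bdry_octChain_succ, antip_sd_pow, map_add]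

end Borsuk

section Gap

/-- If `dim N < dim V`, some nonzero vector of `V` has the origin as a nearest point in `N`
(real case). -/
theorem exists_norm_le_norm_sub_real {X : Type*} [NormedAddCommGroup X] [NormedSpace ℝ X]
    (N V : Submodule ℝ X) [FiniteDimensional ℝ N] (h : Module.rank ℝ N < Module.rank ℝ V) :
    ∃ x ∈ V, x ≠ 0 ∧ ∀ ν ∈ N, ‖x‖ ≤ ‖x - ν‖ := by
  by_contra! hcon
  set n := Module.finrank ℝ N with hn
  have hle : ((n + 1 : ℕ) : Cardinal) ≤ Module.rank ℝ V := by
    rw [← Module.finrank_eq_rank] at h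
    rw [Nat.cast_succ]
    exact Cardinal.add_one_le_of_lt h
  obtain ⟨u, hu⟩ := Module.le_rank_iff_exists_linearMap.1 hle
  have huc : Continuous fun x => (u x : X) :=
    LinearMap.continuous_of_finiteDimensional (V.subtype ∘ₗ u)
  have hu0 : ∀ x : ({0}ᶜ : Set (Fin (n + 1) → ℝ)), (u x : X) ≠ 0 := by
    intro x hx
    refine x.2 (hu ?_)
    rw [map_zero]
    exact Subtype.ext hx
  let t : ({0}ᶜ : Set (Fin (n + 1) → ℝ)) → Set N := fun x => {ν | ‖(u x : X) - ν‖ < ‖(u x : X)‖}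
  obtain ⟨g, hg⟩ := exists_continuous_forall_mem_convex_of_local_const (t := t) (fun x => by
      intro a ha b hb p q hp hq hpq
      have h1 : (u x : X) - (p • a + q • b : N) = p • ((u x : X) - a) + q • ((u x : X) - b) := by
        have : (u x : X) = (p + q) • (u x : X) := by rw [hpq, one_smul]
        simp only [Submodule.coe_add, Submodule.coe_smul]
        rw [smul_sub, smul_sub]
        nth_rw 1 [this]
        rw [add_smul]; abel
      simp only [t, mem_ofPred_eq] at ha hb ⊢
      rw [h1]
      refine (norm_add_le _ _).trans_lt ?_
      rw [norm_smul, norm_smul, Real.norm_of_nonneg hp, Real.norm_of_nonneg hq]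
      rcases hp.eq_or_lt with rfl | hp
      · have : q = 1 := by linarith
        subst this; linarith
      · have h2 := mul_lt_mul_of_pos_left ha hp
        have h3 := mul_le_mul_of_nonneg_left hb.le hq
        have h4 : p * ‖(u x : X)‖ + q * ‖(u x : X)‖ = ‖(u x : X)‖ := by
          rw [← add_mul, hpq, one_mul]
        linarith)
    (fun x => by
      obtain ⟨ν, hν, hlt⟩ := hcon (u x) (u x).2 (hu0 x)
      refine ⟨⟨ν, hν⟩, ?_⟩
      have hc : Continuous fun x : ({0}ᶜ : Set (Fin (n + 1) → ℝ)) => (u x : X) :=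
        huc.comp continuous_subtype_val
      exact (isOpen_lt (hc.sub continuous_const).norm hc.norm).mem_nhds hlt)
  have hgneg : ∀ x : ({0}ᶜ : Set (Fin (n + 1) → ℝ)), -(x : Fin (n + 1) → ℝ) ∈ ({0}ᶜ : Set _) := by
    intro x hx
    exact x.2 (neg_eq_zero.1 hx)
  let G : ({0}ᶜ : Set (Fin (n + 1) → ℝ)) → N := fun x => g x - g ⟨-x, hgneg x⟩
  have hGc : Continuous G := by
    refine g.continuous.sub (g.continuous.comp ?_)
    exact Continuous.subtype_mk (by fun_prop) _
  have hG0 : ∀ x, G x ≠ 0 := by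
    intro x hx
    have h1 : ‖(u x : X) - g x‖ < ‖(u x : X)‖ := hg x
    have h2 : ‖(u (-x) : X) - g ⟨-x, hgneg x⟩‖ < ‖(u (-x) : X)‖ := hg ⟨-x, hgneg x⟩
    rw [← sub_eq_zero.1 hx, map_neg, Submodule.coe_neg, norm_neg, ← norm_neg] at h2
    have h3 : (2 : ℝ) • (u x : X) = ((u x : X) - g x) + -(-(u x : X) - g x) := by
      rw [two_smul]; abel
    have h4 := norm_add_le ((u x : X) - g x) (-(-(u x : X) - g x))
    rw [← h3, norm_smul, Real.norm_two] at h4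
    linarith
  have hGodd : ∀ x : ({0}ᶜ : Set (Fin (n + 1) → ℝ)), G ⟨-x, hgneg x⟩ = - G x := by
    intro x
    simp only [G, neg_neg]
    abel
  obtain ⟨e⟩ : Nonempty (N ≃L[ℝ] (Fin n → ℝ)) := ⟨(LinearEquiv.ofFinrankEq N (Fin n → ℝ)
    (by simp [hn])).toContinuousLinearEquiv⟩
  classical
  let f : (Fin (n + 1) → ℝ) → (Fin n → ℝ) := fun x => if hx : x ∈ ({0}ᶜ : Set _) then e (G ⟨x, hx⟩)
    else 0
  have hfx : ∀ x (hx : x ∈ ({0}ᶜ : Set (Fin (n + 1) → ℝ))), f x = e (G ⟨x, hx⟩) :=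
    fun x hx => dif_pos hx
  obtain ⟨x, hx, hfx0⟩ := exists_zero_of_odd f
    (by
      rw [continuousOn_iff_continuous_domRestrict]
      have : domRestrict ({0}ᶜ) f = fun x => e (G x) := by
        ext1 x; exact hfx x x.2
      rw [this]
      exact e.continuous.comp hGc)
    (fun x hx => by
      rw [hfx x hx, hfx _ (hgneg ⟨x, hx⟩), ← map_neg]
      exact congrArg e (hGodd ⟨x, hx⟩))
  rw [hfx x hx] at hfx0
  exact hG0 ⟨x, hx⟩ (e.map_eq_zero_iff.1 hfx0)

/-- If `dim N < dim V`, some nonzero vector of `V` has the origin as a nearest point in `N`. -/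
theorem exists_norm_le_norm_sub {X : Type*} [NormedAddCommGroup X] [NormedSpace ℂ X]
    (N V : Submodule ℂ X) (hN : Module.rank ℂ N < Cardinal.aleph0)
    (h : Module.rank ℂ N < Module.rank ℂ V) :
    ∃ x ∈ V, x ≠ 0 ∧ ∀ ν ∈ N, ‖x‖ ≤ ‖x - ν‖ := by
  have : FiniteDimensional ℂ N := Module.rank_lt_aleph0_iff.1 hN
  have hN' : FiniteDimensional ℝ (N.restrictScalars ℝ) := FiniteDimensional.complexToReal N
  refine exists_norm_le_norm_sub_real (N.restrictScalars ℝ) (V.restrictScalars ℝ) ?_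
  have h1 : Module.rank ℝ (N.restrictScalars ℝ) = 2 * Module.rank ℂ N := rank_real_of_complex N
  have h2 : Module.rank ℝ (V.restrictScalars ℝ) = 2 * Module.rank ℂ V := rank_real_of_complex V
  rw [h1, h2]
  rw [← Module.finrank_eq_rank] at h ⊢
  have h3 : ((Module.finrank ℂ N + 1 : ℕ) : Cardinal) ≤ Module.rank ℂ V := by
    rw [Nat.cast_succ]
    exact Cardinal.add_one_le_of_lt h
  refine lt_of_lt_of_le ?_ (mul_le_mul_right h3 2)
  norm_cast
  omega

end Gap

section Triangular

/-- A sequence of unit vectors together with norm-one functionals which form a triangular system. -/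
structure IsTriangular {E : Type*} [NormedAddCommGroup E] [NormedSpace ℂ E] (x : ℕ → E)
    (f : ℕ → StrongDual ℂ E) : Prop where
  norm_vec : ∀ k, ‖x k‖ = 1
  norm_fun : ∀ k, ‖f k‖ = 1
  apply_self : ∀ k, f k (x k) = 1
  apply_lt : ∀ m k, m < k → f m (x k) = 0

variable {E : Type*} [NormedAddCommGroup E] [NormedSpace ℂ E]

theorem IsTriangular.norm_coeff_le {x : ℕ → E} {f : ℕ → StrongDual ℂ E} (h : IsTriangular x f)
    {b : ℕ → ℂ} {v : E} (hv : HasSum (fun k => b k • x k) v) (k : ℕ) : ‖b k‖ ≤ 2 ^ k * ‖v‖ := by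
  induction k using Nat.strong_induction_on with
  | _ k ih =>
    have h1 : HasSum (fun j => b j * f k (x j)) (f k v) := by
      simpa using (f k).hasSum hv
    have h2 : f k v = ∑ j ∈ Finset.range (k + 1), b j * f k (x j) := by
      refine h1.unique (hasSum_sum_of_ne_finset_zero fun j hj => ?_)
      rw [h.apply_lt k j (by simpa using hj), mul_zero]
    rw [Finset.sum_range_succ, h.apply_self, mul_one] at h2
    have h3 : b k = f k v - ∑ j ∈ Finset.range k, b j * f k (x j) := by rw [h2]; ring
    have h4 : ∀ w, ‖f k w‖ ≤ ‖w‖ := fun w => by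
      simpa [h.norm_fun k] using (f k).le_opNorm w
    calc ‖b k‖ ≤ ‖f k v‖ + ∑ j ∈ Finset.range k, ‖b j * f k (x j)‖ := by
          rw [h3]
          exact (norm_sub_le _ _).trans (add_le_add_right (norm_sum_le _ _) _)
      _ ≤ ‖v‖ + ∑ j ∈ Finset.range k, 2 ^ j * ‖v‖ := by
          refine add_le_add (h4 v) (Finset.sum_le_sum fun j hj => ?_)
          have h5 := h4 (x j)
          rw [h.norm_vec] at h5
          rw [norm_mul]
          calc ‖b j‖ * ‖f k (x j)‖ ≤ ‖b j‖ * 1 := by gcongr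
            _ ≤ _ := by rw [mul_one]; exact ih j (Finset.mem_range.1 hj)
      _ = 2 ^ k * ‖v‖ := by
          rw [← Finset.sum_mul, geom_sum_eq (by norm_num)]
          ring

/-- Vectors satisfying an open-ended solvability condition can be chosen triangular. -/
theorem exists_isTriangular {P : E → Prop}
    (h : ∀ s : Finset (StrongDual ℂ E), ∃ x, P x ∧ ‖x‖ = 1 ∧ ∀ f ∈ s, f x = 0) :
    ∃ x f, IsTriangular x f ∧ ∀ k, P (x k) := by
  classical
  obtain ⟨u, hu, hlt⟩ := exists_seq_of_forall_finset_exists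
    (fun p : E × StrongDual ℂ E => P p.1 ∧ ‖p.1‖ = 1 ∧ ‖p.2‖ = 1 ∧ p.2 p.1 = 1)
    (fun p q => p.2 q.1 = 0) (by
      intro s _
      obtain ⟨x, hx, hx1, hxs⟩ := h (s.image Prod.snd)
      obtain ⟨f, hf, hfx⟩ := exists_dual_vector ℂ x (by rw [hx1]; exact one_ne_zero)
      refine ⟨(x, f), ⟨hx, hx1, hf, by simp [hfx, hx1]⟩, fun p hp => ?_⟩
      exact hxs _ (Finset.mem_image_of_mem _ hp))
  exact ⟨fun k => (u k).1, fun k => (u k).2, ⟨fun k => (hu k).2.1, fun k => (hu k).2.2.1,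
    fun k => (hu k).2.2.2, hlt⟩, fun k => (hu k).1⟩

end Triangular

section Bounded

variable {X Y W : Type*} [NormedAddCommGroup X] [NormedSpace ℂ X] [NormedAddCommGroup Y]
  [NormedSpace ℂ Y] [SeminormedAddCommGroup W] [NormedSpace ℂ W]

/-- A relation bounded below on vectors having the origin as a nearest point in a
finite-dimensional subspace `N` is bounded below on a subspace of finite codimension, with a bound
depending only on the given one and on `dim N`. -/
theorem exists_finset_bounded_below (G : Submodule ℂ (X × Y)) (N : Submodule ℂ X)
    (hN : Module.rank ℂ N < Cardinal.aleph0) (T : Y →ₗ[ℂ] W) {δ : ℝ} (hδ : 0 < δ)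
    (h : ∀ p ∈ G, (∀ ν ∈ N, ‖p.1‖ ≤ ‖p.1 - ν‖) → δ * ‖p.1‖ ≤ ‖T p.2‖) :
    ∃ s : Finset (StrongDual ℂ X), ∀ p ∈ G, (∀ f ∈ s, f p.1 = 0) →
      δ / 2 ^ (Module.finrank ℂ N + 1) * ‖p.1‖ ≤ ‖T p.2‖ := by
  set n := Module.finrank ℂ N with hn
  have : FiniteDimensional ℂ N := Module.rank_lt_aleph0_iff.1 hN
  by_contra! hcon
  obtain ⟨x, f, hxf, hP⟩ := exists_isTriangular
    (P := fun x => ∃ y, (x, y) ∈ G ∧ ‖T y‖ < δ / 2 ^ (n + 1)) (by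
      intro s
      obtain ⟨⟨x, y⟩, hG, hs, hlt⟩ := hcon s
      simp only at hlt hs
      have hx : 0 < ‖x‖ := by
        by_contra hx
        have : ‖x‖ = 0 := le_antisymm (not_lt.1 hx) (norm_nonneg _)
        rw [this, mul_zero] at hlt
        exact absurd hlt (not_lt.2 (norm_nonneg _))
      have hnorm : ‖((‖x‖⁻¹ : ℝ) : ℂ)‖ = ‖x‖⁻¹ := by
        rw [Complex.norm_real, Real.norm_of_nonneg (by positivity)]
      refine ⟨((‖x‖⁻¹ : ℝ) : ℂ) • x, ⟨((‖x‖⁻¹ : ℝ) : ℂ) • y, G.smul_mem _ hG, ?_⟩, ?_, ?_⟩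
      · rw [map_smul, norm_smul, hnorm, inv_mul_lt_iff₀ hx, mul_comm]
        exact hlt
      · rw [norm_smul, hnorm, inv_mul_cancel₀ hx.ne']
      · intro f hf
        rw [map_smul, hs f hf, smul_zero])
  choose y hyG hylt using hP
  have hsum : ∀ a : Fin (n + 1) → ℂ, HasSum (fun k => (if hk : k < n + 1 then a ⟨k, hk⟩ else 0) • x k)
      (∑ k, a k • x k) := by
    intro a
    have h1 : ∑ k, a k • x k = ∑ k ∈ Finset.range (n + 1),
        (if hk : k < n + 1 then a ⟨k, hk⟩ else 0) • x k := by
      rw [Finset.sum_range]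
      exact Finset.sum_congr rfl fun k _ => by rw [dif_pos k.2]
    rw [h1]
    refine hasSum_sum_of_ne_finset_zero fun k hk => ?_
    rw [dif_neg (by simpa using hk), zero_smul]
  have hcoef : ∀ (a : Fin (n + 1) → ℂ) k, ‖a k‖ ≤ 2 ^ (k : ℕ) * ‖∑ k, a k • x k‖ := by
    intro a k
    have := hxf.norm_coeff_le (hsum a) k
    rwa [dif_pos k.2] at this
  let L : (Fin (n + 1) → ℂ) →ₗ[ℂ] X := Fintype.linearCombination ℂ fun k : Fin (n + 1) => x k
  have hL : ∀ a, L a = ∑ k, a k • x k := fun a => Fintype.linearCombination_apply ℂ _ a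
  have hinj : Function.Injective L := by
    rw [injective_iff_map_eq_zero]
    intro a ha
    ext k
    have := hcoef a k
    rw [← hL, ha, norm_zero, mul_zero] at this
    simpa using this
  obtain ⟨_, ⟨a, rfl⟩, hv0, hv⟩ := exists_norm_le_norm_sub N (LinearMap.range L) hN (by
    refine lt_of_lt_of_le ?_ (Module.le_rank_iff_exists_linearMap (n := n + 1)
      |>.2 ⟨L.rangeRestrict, fun a b hab => hinj (congrArg Subtype.val hab)⟩)
    rw [← Module.finrank_eq_rank]
    exact_mod_cast Nat.lt_succ_self _)
  rw [hL] at hv0 hv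
  set v := ∑ k, a k • x k with hvdef
  have hmem : (v, ∑ k, a k • y k) ∈ G := by
    have : (v, ∑ k, a k • y k) = ∑ k : Fin (n + 1), a k • (x k, y k) := by
      ext <;> simp [hvdef, Prod.fst_sum, Prod.snd_sum]
    rw [this]
    exact G.sum_mem fun k _ => G.smul_mem _ (hyG k)
  have h1 := h _ hmem hv
  simp only at h1
  have hvpos : 0 < ‖v‖ := norm_pos_iff.2 hv0
  have h2 : ‖T (∑ k, a k • y k)‖ ≤ ∑ k : Fin (n + 1), 2 ^ (k : ℕ) * ‖v‖ * (δ / 2 ^ (n + 1)) := by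
    rw [map_sum]
    refine (norm_sum_le _ _).trans (Finset.sum_le_sum fun k _ => ?_)
    rw [map_smul, norm_smul]
    exact mul_le_mul (hcoef a k) (hylt k).le (norm_nonneg _) (by positivity)
  have h3 : ∑ k : Fin (n + 1), 2 ^ (k : ℕ) * ‖v‖ * (δ / 2 ^ (n + 1)) =
      (2 ^ (n + 1) - 1) * (‖v‖ * (δ / 2 ^ (n + 1))) := by
    simp only [mul_assoc]
    rw [← Finset.sum_mul, ← Finset.sum_range (fun k => (2 : ℝ) ^ k), geom_sum_eq (by norm_num)]
    ring
  have h4 : (2 ^ (n + 1) - 1) * (‖v‖ * (δ / 2 ^ (n + 1))) =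
      δ * ‖v‖ - ‖v‖ * (δ / 2 ^ (n + 1)) := by
    field_simp
  have h5 : 0 < ‖v‖ * (δ / 2 ^ (n + 1)) := by positivity
  linarith

/-- A closed relation bounded below on a subspace of finite codimension has, up to a
finite-dimensional summand, a closed range with bounded selections. -/
theorem exists_isClosed_sup_finiteDimensional [CompleteSpace X] [CompleteSpace Y]
    (G : Submodule ℂ (X × Y)) (hG : IsClosed (G : Set (X × Y))) (s : Finset (StrongDual ℂ X))
    {ε : ℝ} (hε : 0 < ε) (h : ∀ p ∈ G, (∀ f ∈ s, f p.1 = 0) → ε * ‖p.1‖ ≤ ‖p.2‖) :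
    ∃ R F : Submodule ℂ Y, IsClosed (R : Set Y) ∧ FiniteDimensional ℂ F ∧ relRanS G = R ⊔ F ∧
      ∀ r ∈ R, ∃ x, (x, r) ∈ G ∧ ε * ‖x‖ ≤ ‖r‖ := by
  let Φ : G →ₗ[ℂ] (s → ℂ) := LinearMap.pi fun f => (f : X →L[ℂ] ℂ).toLinearMap ∘ₗ
    LinearMap.fst ℂ X Y ∘ₗ G.subtype
  have hΦ : ∀ p : G, p ∈ LinearMap.ker Φ ↔ ∀ f ∈ s, f (p : X × Y).1 = 0 := by
    intro p
    rw [LinearMap.mem_ker, funext_iff]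
    simp [Φ]
  obtain ⟨Q, hQ⟩ := (LinearMap.ker Φ).exists_isCompl
  have hQf : FiniteDimensional ℂ Q := by
    refine FiniteDimensional.of_injective (Φ ∘ₗ Q.subtype) ?_
    rw [injective_iff_map_eq_zero]
    intro q hq
    have : (q : G) ∈ LinearMap.ker Φ ⊓ Q := ⟨hq, q.2⟩
    rw [hQ.inf_eq_bot] at this
    exact Subtype.ext this
  let S : G →ₗ[ℂ] Y := LinearMap.snd ℂ X Y ∘ₗ G.subtype
  have hcomplete : CompleteSpace G := hG.completeSpace_coe
  have hker : IsClosed (LinearMap.ker Φ : Set G) := by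
    have : (LinearMap.ker Φ : Set G) = ⋂ f ∈ s, {p : G | f (p : X × Y).1 = 0} := by
      ext p
      simp only [SetLike.mem_coe, hΦ, mem_iInter]
      rfl
    rw [this]
    exact isClosed_biInter fun f _ => isClosed_eq (by fun_prop) continuous_const
  have hkc : CompleteSpace (LinearMap.ker Φ) := hker.completeSpace_coe
  have hbound : ∀ p : LinearMap.ker Φ, ε * ‖(p : X × Y).1‖ ≤ ‖(p : X × Y).2‖ :=
    fun p => h _ p.1.2 ((hΦ _).1 p.2)
  refine ⟨(LinearMap.ker Φ).map S, Q.map S, ?_, inferInstance, ?_, ?_⟩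
  · have hanti : AntilipschitzWith (Real.toNNReal (max 1 ε⁻¹)) (S ∘ₗ (LinearMap.ker Φ).subtype) := by
      refine AddMonoidHomClass.antilipschitz_of_bound (S ∘ₗ (LinearMap.ker Φ).subtype) fun p => ?_
      rw [Real.coe_toNNReal _ (by positivity)]
      change ‖(p : X × Y)‖ ≤ _ * ‖(p : X × Y).2‖
      have h1 := hbound p
      rw [Prod.norm_def]
      refine max_le ?_ ?_
      · rw [mul_comm, ← le_div_iff₀ hε, div_eq_inv_mul] at h1
        exact h1.trans (by gcongr; exact le_max_right _ _)
      · exact le_mul_of_one_le_left (norm_nonneg _) (le_max_left _ _)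
    have huc : UniformContinuous (S ∘ₗ (LinearMap.ker Φ).subtype) :=
      uniformContinuous_snd.comp (uniformContinuous_subtype_val.comp uniformContinuous_subtype_val)
    convert hanti.isClosed_range huc using 1
    ext y
    simp
  · rw [← Submodule.map_sup, hQ.sup_eq_top, Submodule.map_top, relRanS, LinearMap.range_comp,
      Submodule.range_subtype]
  · rintro _ ⟨p, hp, rfl⟩
    exact ⟨(p : X × Y).1, p.2, hbound ⟨p, hp⟩⟩

end Bounded

section Perturbation

/-- The subspace `A(0)` of a linear relation, as a submodule of `Y`. -/
def relMulS {X Y : Type*} [AddCommGroup X] [Module ℂ X] [AddCommGroup Y] [Module ℂ Y]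
    (A : Submodule ℂ (X × Y)) : Submodule ℂ Y := A.comap (LinearMap.inr ℂ X Y)

variable {X Y : Type*} [NormedAddCommGroup X] [NormedSpace ℂ X] [NormedAddCommGroup Y]
  [NormedSpace ℂ Y]

/-- `A` is closed with lower bound `γ`, and `B` is defined on the domain of `A` and bounded by `C`,
modulo `A(0)`. -/
structure RelBounds (A B : Submodule ℂ (X × Y)) (γ C : ℝ) : Prop where
  closed : IsClosed (A : Set (X × Y))
  rank_lt : Module.rank ℂ (relKerS A) < Cardinal.aleph0
  dom : ∀ x y, (x, y) ∈ A → ∃ z, (x, z) ∈ B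
  nonneg : 0 ≤ C
  lt : C < γ
  lower : ∀ x y, (x, y) ∈ A → ∀ δ, (∀ ν ∈ relKerS A, δ ≤ ‖x - ν‖) → γ * δ ≤ ‖(relMulS A).mkQ y‖
  upper : ∀ x z, (x, z) ∈ B → ‖(relMulS A).mkQ z‖ ≤ C * ‖x‖

theorem norm_mkQ_eq_infDist (S : Submodule ℂ Y) (y : Y) : ‖S.mkQ y‖ = infDist y S :=
  QuotientAddGroup.norm_mk (S := S.toAddSubgroup) y

theorem norm_mkQ_le (S : Submodule ℂ Y) (y : Y) : ‖S.mkQ y‖ ≤ ‖y‖ :=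
  Submodule.Quotient.norm_mk_le S y

theorem RelBounds.of_infDist {A B : Submodule ℂ (X × Y)} {γ C : ℝ}
    (hA : IsClosed (A : Set (X × Y))) (hα : Module.rank ℂ (relKerS A) < Cardinal.aleph0)
    (hγ : 0 < γ)
    (hlb : ∀ x y, (x, y) ∈ A → γ * infDist x (relKer A) ≤ infDist y (closure (relMul0 A)))
    (hdom : relDom A ⊆ relDom B) (h0 : relMul0 B ⊆ relMul0 A) (hC0 : 0 ≤ C) (hCγ : C < γ)
    (hbdd : ∀ x z, (x, z) ∈ B → infDist z (relMul0 B) ≤ C * ‖x‖) : RelBounds A B γ C where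
  closed := hA
  rank_lt := hα
  dom x y h := hdom ⟨y, h⟩
  nonneg := hC0
  lt := hCγ
  lower x y h δ hδ := by
    have h1 := hlb x y h
    rw [infDist_closure] at h1
    rw [norm_mkQ_eq_infDist]
    refine le_trans ?_ h1
    refine mul_le_mul_of_nonneg_left ?_ hγ.le
    refine (le_infDist (s := relKer A) ⟨0, A.zero_mem⟩).2 fun ν hν => ?_
    rw [dist_eq_norm]
    exact hδ ν hν
  upper x z h := by
    rw [norm_mkQ_eq_infDist]
    exact (infDist_le_infDist_of_subset h0 ⟨0, B.zero_mem⟩).trans (hbdd x z h)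

/-- The relation `tB`. -/
def smulRel (t : ℂ) (B : Submodule ℂ (X × Y)) : Submodule ℂ (X × Y) :=
  B.map (LinearMap.prodMap LinearMap.id (t • LinearMap.id))

theorem mem_smulRel {t : ℂ} {B : Submodule ℂ (X × Y)} {x : X} {w : Y} :
    (x, w) ∈ smulRel t B ↔ ∃ z, (x, z) ∈ B ∧ t • z = w := by
  simp [smulRel, Submodule.mem_map]

theorem mem_addRel {A B : Submodule ℂ (X × Y)} {x : X} {w : Y} :
    (x, w) ∈ addRel A B ↔ ∃ y z, (x, y) ∈ A ∧ (x, z) ∈ B ∧ w = y + z := Iff.rfl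

theorem smulRel_one (B : Submodule ℂ (X × Y)) : smulRel 1 B = B := by
  ext ⟨x, w⟩
  simp [mem_smulRel]

namespace RelBounds

variable {A B : Submodule ℂ (X × Y)} {γ C : ℝ} (h : RelBounds A B γ C)

include h

theorem smul {t : ℂ} (ht : ‖t‖ ≤ 1) : RelBounds A (smulRel t B) γ C where
  closed := h.closed
  rank_lt := h.rank_lt
  dom x y hxy := by
    obtain ⟨z, hz⟩ := h.dom x y hxy
    exact ⟨t • z, mem_smulRel.2 ⟨z, hz, rfl⟩⟩
  nonneg := h.nonneg
  lt := h.lt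
  lower := h.lower
  upper x w hw := by
    obtain ⟨z, hz, rfl⟩ := mem_smulRel.1 hw
    rw [map_smul, norm_smul]
    exact (mul_le_of_le_one_left (norm_nonneg _) ht).trans (h.upper x z hz)

theorem addRel_smulRel_zero_range : relRanS (addRel A (smulRel 0 B)) = relRanS A := by
  ext w
  simp only [relRanS, Submodule.mem_map, LinearMap.snd_apply, Prod.exists, exists_eq_right]
  constructor
  · rintro ⟨x, y, z, hA, hB, rfl⟩
    obtain ⟨z, -, rfl⟩ := mem_smulRel.1 hB
    exact ⟨x, by simpa using hA⟩
  · rintro ⟨x, hx⟩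
    obtain ⟨z, hz⟩ := h.dom x w hx
    exact ⟨x, w, 0, hx, mem_smulRel.2 ⟨z, hz, zero_smul _ _⟩, by simp⟩

theorem sum_lower (p : X × Y) (hp : p ∈ addRel A B)
    (hnear : ∀ ν ∈ relKerS A, ‖p.1‖ ≤ ‖p.1 - ν‖) :
    (γ - C) * ‖p.1‖ ≤ ‖(relMulS A).mkQ p.2‖ := by
  obtain ⟨x, w⟩ := p
  obtain ⟨y, z, hA, hB, rfl⟩ := mem_addRel.1 hp
  have h1 := h.lower x y hA _ hnear
  have h2 := h.upper x z hB
  have h3 := norm_sub_le_norm_add ((relMulS A).mkQ y) ((relMulS A).mkQ z)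
  rw [← map_add] at h3
  simp only
  linarith

theorem rank_relKerS_le : Module.rank ℂ (relKerS (addRel A B)) ≤ Module.rank ℂ (relKerS A) := by
  by_contra! hlt
  obtain ⟨x, hx, hx0, hnear⟩ := exists_norm_le_norm_sub _ _ h.rank_lt hlt
  have h1 := h.sum_lower (x, 0) hx hnear
  simp only [map_zero, norm_zero] at h1
  have := mul_pos (sub_pos.2 h.lt) (norm_pos_iff.2 hx0)
  linarith

theorem isClosed_relMulS : IsClosed (relMulS A : Set Y) :=
  h.closed.preimage (f := fun y : Y => ((0 : X), y)) (by fun_prop)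

theorem isClosed_mkQ_image [CompleteSpace Y] :
    IsClosed {p : X × (Y ⧸ relMulS A) | ∃ y, (relMulS A).mkQ y = p.2 ∧ (p.1, y) ∈ A} := by
  have hq : IsOpenQuotientMap (Prod.map (id : X → X) (relMulS A).mkQ) :=
    IsOpenQuotientMap.id.prodMap (relMulS A).isOpenQuotientMap_mkQ
  rw [← hq.isQuotientMap.isClosed_preimage]
  convert h.closed using 1
  ext ⟨x, y⟩
  simp only [mem_preimage, mem_ofPred_eq, Prod.map_apply, id_eq, SetLike.mem_coe]
  constructor
  · rintro ⟨y', hy', hA⟩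
    have h1 : y - y' ∈ relMulS A := by
      rw [← Submodule.ker_mkQ (relMulS A), LinearMap.mem_ker, map_sub, hy', sub_self]
    have h2 : ((0 : X), y - y') ∈ A := h1
    have := A.add_mem hA h2
    simpa using this
  · exact fun hA => ⟨y, rfl, hA⟩

theorem isClosed_addRel [CompleteSpace Y] : IsClosed (addRel A B : Set (X × Y)) := by
  have hcl := h.isClosed_relMulS
  have hq := (relMulS A).isOpenQuotientMap_mkQ.continuous
  refine IsSeqClosed.isClosed ?_
  rintro u ⟨x, w⟩ hu hlim
  have hx : Filter.Tendsto (fun k => (u k).1) Filter.atTop (nhds x) :=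
    (continuous_fst.tendsto _).comp hlim
  have hw : Filter.Tendsto (fun k => (u k).2) Filter.atTop (nhds w) :=
    (continuous_snd.tendsto _).comp hlim
  choose y z hA hB hyz using hu
  have hdiff : ∀ {x₁ x₂ z₁ z₂}, (x₁, z₁) ∈ B → (x₂, z₂) ∈ B →
      ‖(relMulS A).mkQ z₁ - (relMulS A).mkQ z₂‖ ≤ C * ‖x₁ - x₂‖ := fun h1 h2 => by
    rw [← map_sub]
    exact h.upper _ _ (B.sub_mem h1 h2)
  have hcau : CauchySeq fun k => (relMulS A).mkQ (z k) := by
    have hxc := hx.cauchySeq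
    rw [Metric.cauchySeq_iff] at hxc ⊢
    intro ε hε
    obtain ⟨M, hM⟩ := hxc (ε / (C + 1)) (div_pos hε (by linarith [h.nonneg]))
    refine ⟨M, fun m hm k hk => ?_⟩
    have h1 := hM m hm k hk
    rw [dist_eq_norm] at h1 ⊢
    have h2 := hdiff (hB m) (hB k)
    rw [lt_div_iff₀ (by linarith [h.nonneg])] at h1
    have h3 := norm_nonneg ((u m).1 - (u k).1)
    linarith
  obtain ⟨ζ, hζ⟩ := cauchySeq_tendsto_of_complete hcau
  obtain ⟨y', hy', hA'⟩ := h.isClosed_mkQ_image.mem_of_tendsto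
    (f := fun k => ((u k).1, (relMulS A).mkQ (u k).2 - (relMulS A).mkQ (z k)))
    (hx.prodMk_nhds (((hq.tendsto w).comp hw).sub hζ))
    (Filter.Eventually.of_forall fun k => ⟨y k, by simp [hyz k], hA k⟩)
  simp only at hy' hA'
  obtain ⟨z', hz'⟩ := h.dom x y' hA'
  have hlim' : Filter.Tendsto (fun k => (relMulS A).mkQ (z k)) Filter.atTop
      (nhds ((relMulS A).mkQ z')) := by
    rw [tendsto_iff_norm_sub_tendsto_zero] at hx ⊢
    refine squeeze_zero (fun _ => norm_nonneg _) (fun k => hdiff (hB k) hz') ?_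
    simpa using hx.const_mul C
  have : ζ = (relMulS A).mkQ z' := tendsto_nhds_unique hζ hlim'
  have hmem : w - z' - y' ∈ relMulS A := by
    rw [← Submodule.ker_mkQ (relMulS A), LinearMap.mem_ker, map_sub, map_sub, hy', this, sub_self]
  have hmem' : ((0 : X), w - z' - y') ∈ A := hmem
  refine mem_addRel.2 ⟨w - z', z', ?_, hz', by simp⟩
  simpa using A.add_mem hA' hmem'

end RelBounds

end Perturbation

section Deficiency

variable {X Y : Type*} [NormedAddCommGroup X] [NormedSpace ℂ X] [NormedAddCommGroup Y]
  [NormedSpace ℂ Y]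

/-- The annihilator of a subspace in the topological dual. -/
noncomputable def strongAnnihilator (R : Submodule ℂ Y) : Submodule ℂ (StrongDual ℂ Y) :=
  R.dualAnnihilator.comap (ContinuousLinearMap.coeLM ℂ)

theorem mem_strongAnnihilator {R : Submodule ℂ Y} {f : StrongDual ℂ Y} :
    f ∈ strongAnnihilator R ↔ ∀ y ∈ R, f y = 0 := by
  simp [strongAnnihilator, Submodule.mem_dualAnnihilator]

theorem rank_strongAnnihilator_le (R : Submodule ℂ Y)
    (hR : Module.rank ℂ (Y ⧸ R) < Cardinal.aleph0) :
    Module.rank ℂ (strongAnnihilator R) ≤ Module.rank ℂ (Y ⧸ R) := by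
  have : FiniteDimensional ℂ (Y ⧸ R) := Module.rank_lt_aleph0_iff.1 hR
  let j : strongAnnihilator R →ₗ[ℂ] R.dualAnnihilator :=
    (ContinuousLinearMap.coeLM ℂ).restrict fun f hf => hf
  have hj : Function.Injective j := by
    intro f g hfg
    have := congrArg Subtype.val hfg
    exact Subtype.ext (ContinuousLinearMap.coe_injective this)
  let k : strongAnnihilator R →ₗ[ℂ] Module.Dual ℂ (Y ⧸ R) :=
    R.dualQuotEquivDualAnnihilator.symm.toLinearMap ∘ₗ j
  have hk : Function.Injective k := R.dualQuotEquivDualAnnihilator.symm.injective.comp hj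
  have : FiniteDimensional ℂ (strongAnnihilator R) := FiniteDimensional.of_injective k hk
  rw [← Module.finrank_eq_rank, ← Module.finrank_eq_rank, Nat.cast_le]
  exact (LinearMap.finrank_le_finrank_of_injective hk).trans_eq Subspace.dual_finrank_eq

theorem exists_dual_family {W : Type*} [NormedAddCommGroup W] [NormedSpace ℂ W] {k : ℕ}
    (L : (Fin k → ℂ) →ₗ[ℂ] W) (hL : Function.Injective L) (i : Fin k) :
    ∃ g : StrongDual ℂ W, ∀ a, g (L a) = a i := by
  let e := LinearEquiv.ofInjective L hL
  let φ : StrongDual ℂ (LinearMap.range L) :=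
    LinearMap.toContinuousLinearMap (LinearMap.proj i ∘ₗ e.symm.toLinearMap)
  obtain ⟨g, hg, -⟩ := exists_extension_norm_eq _ φ
  refine ⟨g, fun a => ?_⟩
  have h1 := hg (e a)
  have h2 : ((e a : LinearMap.range L) : W) = L a := LinearEquiv.ofInjective_apply L a
  rw [h2] at h1
  rw [h1]
  simp [φ]

theorem natCast_le_rank_strongAnnihilator (R : Submodule ℂ Y) (hR : IsClosed (R : Set Y)) {k : ℕ}
    (hk : (k : Cardinal) ≤ Module.rank ℂ (Y ⧸ R)) :
    (k : Cardinal) ≤ Module.rank ℂ (strongAnnihilator R) := by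
  obtain ⟨L, hL⟩ := Module.le_rank_iff_exists_linearMap.1 hk
  choose g hg using exists_dual_family L hL
  let q : Y →L[ℂ] Y ⧸ R := ⟨R.mkQ, R.isOpenQuotientMap_mkQ.continuous⟩
  have hq : ∀ i, (g i).comp q ∈ strongAnnihilator R := by
    intro i
    rw [mem_strongAnnihilator]
    intro y hy
    have : R.mkQ y = 0 := (Submodule.Quotient.mk_eq_zero R).2 hy
    change g i (R.mkQ y) = 0
    rw [this, map_zero]
  refine Module.le_rank_iff_exists_linearMap.2 ⟨Fintype.linearCombination ℂ fun i =>
    (⟨(g i).comp q, hq i⟩ : strongAnnihilator R), ?_⟩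
  rw [injective_iff_map_eq_zero]
  intro a ha
  have h1 : ∀ y, ∑ i, a i * g i (R.mkQ y) = 0 := by
    intro y
    have := congrArg (fun f : strongAnnihilator R => (f : StrongDual ℂ Y) y) ha
    have h2 : ∑ i, a i * g i (q y) = 0 := by
      simpa [Fintype.linearCombination_apply] using this
    exact h2
  ext j
  obtain ⟨y, hy⟩ := R.mkQ_surjective (L (Pi.single j 1))
  have := h1 y
  rw [hy] at this
  simpa [hg, Pi.single_apply] using this

namespace RelBounds

variable {A B : Submodule ℂ (X × Y)} {γ C : ℝ} (h : RelBounds A B γ C)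

include h

theorem norm_apply_le {f : StrongDual ℂ Y} (hf : f ∈ strongAnnihilator (relRanS (addRel A B)))
    {x : X} {y : Y} (hxy : (x, y) ∈ A) : ‖f y‖ ≤ C / γ * ‖f‖ * ‖y‖ := by
  have hγ : 0 < γ := h.nonneg.trans_lt h.lt
  rw [mem_strongAnnihilator] at hf
  have hf0 : ∀ s ∈ relMulS A, f s = 0 := fun s hs =>
    hf s ⟨((0 : X), s), mem_addRel.2 ⟨s, 0, hs, B.zero_mem, by simp⟩, rfl⟩
  have hquot : ∀ z, ‖f z‖ ≤ ‖f‖ * ‖(relMulS A).mkQ z‖ := by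
    intro z
    rcases (norm_nonneg f).eq_or_lt with h0 | hpos
    · have := f.le_opNorm z
      rw [← h0, zero_mul] at this ⊢
      exact this
    · rw [mul_comm, ← div_le_iff₀ hpos, norm_mkQ_eq_infDist]
      refine (le_infDist (s := (relMulS A : Set Y)) ⟨0, zero_mem _⟩).2 fun s hs => ?_
      rw [div_le_iff₀ hpos, mul_comm, dist_eq_norm]
      have := f.le_opNorm (z - s)
      rwa [map_sub, hf0 s hs, sub_zero] at this
  have hx : ∀ x, (x, y) ∈ A → ‖f y‖ ≤ ‖f‖ * C * ‖x‖ := by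
    intro x hxy
    obtain ⟨z, hz⟩ := h.dom x y hxy
    have h1 : f (y + z) = 0 := hf _ ⟨(x, y + z), mem_addRel.2 ⟨y, z, hxy, hz, rfl⟩, rfl⟩
    rw [map_add, add_eq_zero_iff_eq_neg] at h1
    rw [h1, norm_neg, mul_assoc]
    exact (hquot z).trans (mul_le_mul_of_nonneg_left (h.upper x z hz) (norm_nonneg _))
  have hν : ∀ ν ∈ relKerS A, ‖f y‖ ≤ ‖f‖ * C * ‖x - ν‖ := by
    intro ν hν
    have hν' : (ν, (0 : Y)) ∈ A := hν
    have := A.sub_mem hxy hν'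
    rw [Prod.mk_sub_mk, sub_zero] at this
    exact hx _ this
  have hK : 0 ≤ ‖f‖ * C := mul_nonneg (norm_nonneg _) h.nonneg
  rcases hK.eq_or_lt with h0 | hpos
  · have := hx x hxy
    rw [← h0, zero_mul] at this
    refine this.trans ?_
    have := h.nonneg
    positivity
  · have h1 := h.lower x y hxy (‖f y‖ / (‖f‖ * C)) fun ν hνA => by
      rw [div_le_iff₀ hpos, mul_comm]
      exact hν ν hνA
    have h2 := h1.trans (norm_mkQ_le _ y)
    rw [mul_div_assoc', div_le_iff₀ hpos] at h2
    rw [div_mul_eq_mul_div, div_mul_eq_mul_div, le_div_iff₀ hγ]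
    linarith

theorem rank_quotient_le_of_finite (hcl : IsClosed (relRanS (addRel A B) : Set Y))
    (hfin : Module.rank ℂ (Y ⧸ relRanS A) < Cardinal.aleph0) :
    Module.rank ℂ (Y ⧸ relRanS (addRel A B)) ≤ Module.rank ℂ (Y ⧸ relRanS A) := by
  have hγ : 0 < γ := h.nonneg.trans_lt h.lt
  by_contra! hlt
  have : FiniteDimensional ℂ (Y ⧸ relRanS A) := Module.rank_lt_aleph0_iff.1 hfin
  have hle := rank_strongAnnihilator_le _ hfin
  have h1 : ((Module.finrank ℂ (Y ⧸ relRanS A) + 1 : ℕ) : Cardinal) ≤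
      Module.rank ℂ (strongAnnihilator (relRanS (addRel A B))) := by
    refine natCast_le_rank_strongAnnihilator _ hcl ?_
    rw [Nat.cast_succ, Module.finrank_eq_rank]
    exact Cardinal.add_one_le_of_lt hlt
  rw [← Module.finrank_eq_rank ℂ (Y ⧸ relRanS A)] at hle
  have hlt' := hle.trans_lt ((Nat.cast_lt.2 (Nat.lt_succ_self _)).trans_le h1)
  obtain ⟨f, hf, hf0, hnear⟩ := exists_norm_le_norm_sub (strongAnnihilator (relRanS A)) _
    (hle.trans_lt (Cardinal.natCast_lt_aleph0)) hlt'
  obtain ⟨g, hg, hgn⟩ := exists_extension_norm_eq (relRanS A) (f.comp (relRanS A).subtypeL)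
  have h2 : ‖f‖ ≤ ‖f - (f - g)‖ := by
    refine hnear _ (mem_strongAnnihilator.2 fun y hy => ?_)
    have := hg ⟨y, hy⟩
    simp only at this
    simp [this]
  rw [sub_sub_cancel, hgn] at h2
  have h3 : ‖f.comp (relRanS A).subtypeL‖ ≤ C / γ * ‖f‖ := by
    have := h.nonneg
    refine ContinuousLinearMap.opNorm_le_bound _ (by positivity) ?_
    rintro ⟨y, ⟨x, y⟩, hxy, rfl⟩
    exact h.norm_apply_le hf hxy
  have h4 := norm_pos_iff.2 hf0
  have h5 : C / γ < 1 := (div_lt_one hγ).2 h.lt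
  nlinarith

theorem exists_isClosed_sup [CompleteSpace X] [CompleteSpace Y] :
    ∃ R F : Submodule ℂ Y, IsClosed (R : Set Y) ∧ FiniteDimensional ℂ F ∧
      relRanS (addRel A B) = R ⊔ F ∧ ∀ r ∈ R, ∃ x, (x, r) ∈ addRel A B ∧
        (γ - C) / 2 ^ (Module.finrank ℂ (relKerS A) + 1) * ‖x‖ ≤ ‖r‖ := by
  have hlt := sub_pos.2 h.lt
  obtain ⟨s, hs⟩ := exists_finset_bounded_below (addRel A B) _ h.rank_lt (relMulS A).mkQ hlt
    h.sum_lower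
  exact exists_isClosed_sup_finiteDimensional _ h.isClosed_addRel s (by positivity)
    fun p hp hps => (hs p hp hps).trans (norm_mkQ_le _ _)

theorem isClosed_relRanS [CompleteSpace X] [CompleteSpace Y] :
    IsClosed (relRanS (addRel A B) : Set Y) := by
  obtain ⟨R, F, hR, hF, hsup, -⟩ := h.exists_isClosed_sup
  rw [hsup]
  exact Submodule.isClosed_sup_finiteDimensional _ _ hR

end RelBounds

end Deficiency

section BanachCardinal

variable {Z : Type*} [NormedAddCommGroup Z] [NormedSpace ℂ Z]

theorem exists_norm_eq_one_forall_apply_eq_zero (hZ : Cardinal.aleph0 ≤ Module.rank ℂ Z)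
    (s : Finset (StrongDual ℂ Z)) : ∃ x : Z, ‖x‖ = 1 ∧ ∀ f ∈ s, f x = 0 := by
  let Φ : Z →ₗ[ℂ] (s → ℂ) := LinearMap.pi fun f => (f : Z →L[ℂ] ℂ).toLinearMap
  have hΦ : ¬ Function.Injective Φ := fun hinj => by
    have : FiniteDimensional ℂ Z := FiniteDimensional.of_injective Φ hinj
    exact absurd (Module.rank_lt_aleph0_iff.2 this) (not_lt.2 hZ)
  rw [injective_iff_map_eq_zero] at hΦ
  push Not at hΦ
  obtain ⟨x, hx, hx0⟩ := hΦ
  refine ⟨((‖x‖⁻¹ : ℝ) : ℂ) • x, ?_, fun f hf => ?_⟩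
  · rw [norm_smul, Complex.norm_real, Real.norm_of_nonneg (by positivity),
      inv_mul_cancel₀ (norm_ne_zero_iff.2 hx0)]
  · rw [map_smul, show f x = 0 from congrFun hx ⟨f, hf⟩, smul_zero]

theorem continuum_le_rank [CompleteSpace Z] (hZ : Cardinal.aleph0 ≤ Module.rank ℂ Z) :
    Cardinal.continuum ≤ Module.rank ℂ Z := by
  obtain ⟨x, f, h, -⟩ := exists_isTriangular (P := fun _ : Z => True) fun s =>
    (exists_norm_eq_one_forall_apply_eq_zero hZ s).imp fun x hx => ⟨trivial, hx⟩
  have hsum : ∀ t : Ioo (0 : ℝ) 1, Summable fun k : ℕ => ((t : ℝ) : ℂ) ^ k • x k := fun t => by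
    refine Summable.of_norm ?_
    simp only [norm_smul, norm_pow, Complex.norm_real, h.norm_vec, mul_one]
    exact summable_geometric_of_lt_one (norm_nonneg _) (by
      rw [Real.norm_of_nonneg t.2.1.le]; exact t.2.2)
  have hli : LinearIndependent ℂ fun t : Ioo (0 : ℝ) 1 => ∑' k : ℕ, ((t : ℝ) : ℂ) ^ k • x k := by
    have h1 := (linearIndependent_monoidHom (Multiplicative ℕ) ℂ).comp
      (fun t : Ioo (0 : ℝ) 1 => powersHom ℂ ((t : ℝ) : ℂ)) (fun s t hst => by
        exact Subtype.ext (by simpa using hst))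
    rw [linearIndependent_iff'] at h1 ⊢
    intro s c hc
    refine h1 s c (funext fun k => ?_)
    have h2 : HasSum (fun k : ℕ => (∑ t ∈ s, c t * ((t : ℝ) : ℂ) ^ k) • x k) 0 := by
      rw [← hc]
      simp only [Finset.sum_smul, mul_smul]
      exact hasSum_sum fun t _ => (hsum t).hasSum.const_smul (c t)
    have h3 := h.norm_coeff_le h2 k.toAdd
    rw [norm_zero, mul_zero, norm_le_zero_iff] at h3
    simpa [Finset.sum_apply] using h3
  have := hli.cardinal_lift_le_rank
  rwa [Cardinal.mk_Ioo_real one_pos, Cardinal.lift_continuum, Cardinal.lift_uzero] at this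

theorem mk_eq_rank [CompleteSpace Z] (hZ : Cardinal.aleph0 ≤ Module.rank ℂ Z) :
    Cardinal.mk Z = Module.rank ℂ Z := by
  refine le_antisymm ?_ (rank_le_card ℂ Z)
  have b := Module.Basis.ofVectorSpace ℂ Z
  have hb : Cardinal.mk (Module.Basis.ofVectorSpaceIndex ℂ Z) = Module.rank ℂ Z := b.mk_eq_rank''
  have : Infinite (Module.Basis.ofVectorSpaceIndex ℂ Z) := by
    rw [Cardinal.infinite_iff, hb]; exact hZ
  rw [Cardinal.mk_congr b.repr.toEquiv, Cardinal.mk_finsupp_lift_of_infinite, hb]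
  simp [continuum_le_rank hZ]

theorem exists_maximal_separated (Z : Type*) [NormedAddCommGroup Z] :
    ∃ S : Set Z, (∀ s ∈ S, ‖s‖ ≤ 1) ∧ (∀ s ∈ S, ∀ t ∈ S, s ≠ t → 1 / 2 < ‖s - t‖) ∧
      ∀ z : Z, ‖z‖ ≤ 1 → ∃ s ∈ S, ‖z - s‖ ≤ 1 / 2 := by
  obtain ⟨S, hS⟩ := zorn_subset
    {S : Set Z | (∀ s ∈ S, ‖s‖ ≤ 1) ∧ S.Pairwise fun s t => 1 / 2 < ‖s - t‖} (by
      intro c hc hchain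
      refine ⟨⋃₀ c, ⟨?_, ?_⟩, fun s hs => subset_sUnion_of_mem hs⟩
      · rintro s ⟨T, hT, hs⟩
        exact (hc hT).1 s hs
      · exact (pairwise_sUnion hchain.directedOn).2 fun T hT => (hc hT).2)
  refine ⟨S, hS.prop.1, fun s hs t ht => hS.prop.2 hs ht, fun z hz => ?_⟩
  by_contra! hcon
  have hins : insert z S ⊆ S := hS.le_of_ge ⟨?_, ?_⟩ (subset_insert z S)
  · have := hcon z (hins (mem_insert z S))
    norm_num at this
  · rintro s (rfl | hs)
    exacts [hz, hS.prop.1 s hs]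
  · refine hS.prop.2.insert fun t ht _ => ⟨hcon t ht, ?_⟩
    rw [norm_sub_rev]
    exact hcon t ht

theorem power_mk_le_of_separated [CompleteSpace Z] {S : Set Z} (hS : ∀ s ∈ S, ‖s‖ ≤ 1)
    (hsep : ∀ s ∈ S, ∀ t ∈ S, s ≠ t → 1 / 2 < ‖s - t‖) :
    Cardinal.mk S ^ Cardinal.aleph0 ≤ Cardinal.mk Z := by
  let φ : (ℕ → S) → Z := fun u => ∑' n, ((1 / 8 : ℂ) ^ n) • (u n : Z)
  have hle : ∀ (u : ℕ → S) n, ‖((1 / 8 : ℂ) ^ n) • (u n : Z)‖ ≤ (1 / 8 : ℝ) ^ n := fun u n => by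
    rw [norm_smul, norm_pow]
    norm_num
    exact hS _ (u n).2
  have hgeo : Summable fun n : ℕ => (1 / 8 : ℝ) ^ n :=
    summable_geometric_of_lt_one (by norm_num) (by norm_num)
  have hsum : ∀ u : ℕ → S, Summable fun n => ((1 / 8 : ℂ) ^ n) • (u n : Z) := fun u =>
    Summable.of_norm_bounded hgeo (hle u)
  have hnorm : ∀ u, ‖φ u‖ ≤ 8 / 7 := fun u => by
    refine (tsum_of_norm_bounded hgeo.hasSum (hle u)).trans ?_
    rw [tsum_geometric_of_lt_one (by norm_num) (by norm_num)]
    norm_num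
  have hφ : ∀ u, φ u = u 0 + (1 / 8 : ℂ) • φ (fun n => u (n + 1)) := fun u => by
    simp only [φ]
    rw [(hsum u).tsum_eq_zero_add, ← (hsum _).tsum_const_smul]
    simp only [pow_zero, one_smul, smul_smul, pow_succ']
  have key : ∀ u v, φ u = φ v → u 0 = v 0 ∧ φ (fun n => u (n + 1)) = φ (fun n => v (n + 1)) := by
    intro u v huv
    rw [hφ u, hφ v] at huv
    have h0 : u 0 = v 0 := by
      by_contra hne
      have h1 := hsep _ (u 0).2 _ (v 0).2 fun h => hne (Subtype.ext h)
      have h2 : (u 0 - v 0 : Z) =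
          (1 / 8 : ℂ) • (φ (fun n => v (n + 1)) - φ (fun n => u (n + 1))) := by
        rw [smul_sub, sub_eq_sub_iff_add_eq_add, huv, add_comm]
      rw [h2, norm_smul] at h1
      have h3 := norm_sub_le (φ fun n => v (n + 1)) (φ fun n => u (n + 1))
      have h4 := hnorm fun n => v (n + 1)
      have h5 := hnorm fun n => u (n + 1)
      norm_num at h1
      linarith
    refine ⟨h0, ?_⟩
    rw [h0] at huv
    exact smul_right_injective Z (by norm_num : (1 / 8 : ℂ) ≠ 0) (add_left_cancel huv)
  have hinj : Function.Injective φ := by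
    intro u v huv
    have : ∀ n, ∀ u v : ℕ → S, φ u = φ v → u n = v n := by
      intro n
      induction n with
      | zero => exact fun u v h => (key u v h).1
      | succ n ih => exact fun u v h => ih _ _ (key u v h).2
    exact funext fun n => this n u v huv
  have := Cardinal.mk_le_of_injective hinj
  rwa [Cardinal.mk_pi, Cardinal.prod_const, Cardinal.mk_nat, Cardinal.lift_aleph0,
    Cardinal.lift_uzero] at this

theorem mk_le_power_of_cover {S : Set Z} (hcov : ∀ z : Z, ‖z‖ ≤ 1 → ∃ s ∈ S, ‖z - s‖ ≤ 1 / 2) :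
    Cardinal.mk Z ≤ Cardinal.aleph0 * Cardinal.mk S ^ Cardinal.aleph0 := by
  have hcov' : ∀ z : closedBall (0 : Z) 1, ∃ s : S, ‖(z : Z) - s‖ ≤ 1 / 2 := fun z => by
    obtain ⟨s, hs, h⟩ := hcov z (mem_closedBall_zero_iff.1 z.2)
    exact ⟨⟨s, hs⟩, h⟩
  choose σ hσ using hcov'
  let T : closedBall (0 : Z) 1 → closedBall (0 : Z) 1 := fun z =>
    ⟨(2 : ℂ) • ((z : Z) - σ z), by
      have := hσ z
      rw [mem_closedBall_zero_iff, norm_smul]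
      norm_num
      linarith⟩
  have hdist : ∀ n (z w : closedBall (0 : Z) 1), (∀ k, σ (T^[k] z) = σ (T^[k] w)) →
      2 ^ n * ‖(z - w : Z)‖ ≤ 2 := by
    intro n
    induction n with
    | zero =>
      intro z w _
      have h1 := mem_closedBall_zero_iff.1 z.2
      have h2 := mem_closedBall_zero_iff.1 w.2
      have h3 := norm_sub_le (z : Z) w
      linarith
    | succ n ih =>
      intro z w hzw
      have h1 := ih (T z) (T w) fun k => hzw (k + 1)
      have h2 : σ z = σ w := hzw 0
      have h3 : (T z - T w : Z) = (2 : ℂ) • (z - w : Z) := by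
        simp only [T, h2, smul_sub]
        abel
      rw [h3, norm_smul] at h1
      norm_num at h1
      rw [pow_succ]
      linarith
  have hinj : Function.Injective fun (z : closedBall (0 : Z) 1) (k : ℕ) => σ (T^[k] z) := by
    intro z w hzw
    by_contra hne
    have hpos : 0 < ‖(z - w : Z)‖ := norm_pos_iff.2 (sub_ne_zero.2 fun h => hne (Subtype.ext h))
    obtain ⟨n, hn⟩ := pow_unbounded_of_one_lt (2 / ‖(z - w : Z)‖) (one_lt_two : (1 : ℝ) < 2)
    rw [div_lt_iff₀ hpos] at hn
    exact absurd (hdist n z w fun k => congrFun hzw k) (not_le.2 hn)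
  have h1 := Cardinal.mk_le_of_injective hinj
  rw [Cardinal.mk_pi, Cardinal.prod_const, Cardinal.mk_nat, Cardinal.lift_aleph0,
    Cardinal.lift_uzero] at h1
  have hsurj : Function.Surjective
      fun p : ℕ × closedBall (0 : Z) 1 => ((p.1 : ℂ) + 1) • (p.2 : Z) := by
    intro z
    obtain ⟨n, hn⟩ := exists_nat_ge ‖z‖
    have hn0 : ((n : ℂ) + 1) ≠ 0 := Nat.cast_add_one_ne_zero n
    refine ⟨(n, ⟨((n : ℂ) + 1)⁻¹ • z, ?_⟩), smul_inv_smul₀ hn0 z⟩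
    have hn1 : ‖(n : ℂ) + 1‖ = n + 1 := by
      rw [← Nat.cast_add_one, Complex.norm_natCast, Nat.cast_add_one]
    rw [mem_closedBall_zero_iff, norm_smul, norm_inv, hn1]
    exact inv_mul_le_one_of_le₀ (by linarith) (by positivity)
  have h2 := Cardinal.mk_le_of_surjective hsurj
  rw [Cardinal.mk_prod, Cardinal.mk_nat, Cardinal.lift_aleph0, Cardinal.lift_uzero] at h2
  exact h2.trans (mul_le_mul_right h1 _)

/-- The cardinality `κ` of a nontrivial Banach space satisfies `κ ^ ℵ₀ = κ`. -/
theorem mk_power_aleph0_le [CompleteSpace Z] [Nontrivial Z] :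
    Cardinal.mk Z ^ Cardinal.aleph0 ≤ Cardinal.mk Z := by
  obtain ⟨S, hS, hsep, hcov⟩ := exists_maximal_separated Z
  have h2 : 2 ≤ Cardinal.mk S := by
    obtain ⟨x, hx⟩ := exists_norm_eq Z (zero_le_one' ℝ)
    obtain ⟨s, hs, hxs⟩ := hcov x hx.le
    obtain ⟨t, ht, hxt⟩ := hcov (-x) (by rw [norm_neg, hx])
    rw [Cardinal.two_le_iff]
    refine ⟨⟨s, hs⟩, ⟨t, ht⟩, fun hst => ?_⟩
    obtain rfl : s = t := congrArg Subtype.val hst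
    have h1 : (2 : ℂ) • x = (x - s) - (-x - s) := by rw [two_smul]; abel
    have h3 := norm_sub_le (x - s) (-x - s)
    rw [← h1, norm_smul, hx] at h3
    norm_num at h3
    linarith
  have h3 : Cardinal.aleph0 ≤ Cardinal.mk S ^ Cardinal.aleph0 :=
    (Cardinal.cantor _).le.trans (Cardinal.power_le_power_right h2)
  have h4 : Cardinal.mk Z ≤ Cardinal.mk S ^ Cardinal.aleph0 :=
    (mk_le_power_of_cover hcov).trans (by
      rw [Cardinal.aleph0_mul_eq h3])
  calc Cardinal.mk Z ^ Cardinal.aleph0 ≤ (Cardinal.mk S ^ Cardinal.aleph0) ^ Cardinal.aleph0 :=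
        Cardinal.power_le_power_right h4
    _ = Cardinal.mk S ^ Cardinal.aleph0 := by
        rw [← Cardinal.power_mul, Cardinal.aleph0_mul_aleph0]
    _ ≤ Cardinal.mk Z := power_mk_le_of_separated hS hsep

end BanachCardinal

section Step

variable {Y : Type*} [NormedAddCommGroup Y] [NormedSpace ℂ Y]

theorem mk_quotient_le_of_norm_sub_le {R R' : Submodule ℂ Y} (hR' : IsClosed (R' : Set Y))
    (h : ∀ r ∈ R, ∃ r' ∈ R', ‖r - r'‖ ≤ 1 / 4 * ‖r‖) :
    Cardinal.mk (Y ⧸ R') ≤ (Cardinal.mk (Y ⧸ R) * Cardinal.continuum) ^ Cardinal.aleph0 := by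
  have hW : ∀ (q : Y ⧸ R) (ρ : ℝ), ∃ w : Y, ∀ y : Y, R.mkQ y = q → ‖y‖ = ρ →
      R.mkQ w = q ∧ ‖w‖ = ρ := by
    intro q ρ
    by_cases hex : ∃ y : Y, R.mkQ y = q ∧ ‖y‖ = ρ
    · obtain ⟨w, hw⟩ := hex
      exact ⟨w, fun _ _ _ => hw⟩
    · exact ⟨0, fun y h1 h2 => absurd ⟨y, h1, h2⟩ hex⟩
  choose W hW using hW
  let w : Y → Y := fun y => W (R.mkQ y) ‖y‖
  have hT : ∀ y : Y, ∃ z : Y, ‖z‖ ≤ 1 / 2 * ‖y‖ ∧ y - w y - z ∈ R' := by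
    intro y
    obtain ⟨h1, h2⟩ := hW _ _ y rfl rfl
    have h3 : y - w y ∈ R := by
      rw [← Submodule.ker_mkQ R, LinearMap.mem_ker, map_sub, h1, sub_self]
    obtain ⟨r', hr', hle⟩ := h _ h3
    refine ⟨y - w y - r', ?_, by rwa [sub_sub_cancel]⟩
    have h4 := norm_sub_le y (w y)
    have h5 : ‖w y‖ = ‖y‖ := h2
    linarith
  choose T hTn hTm using hT
  have hiter : ∀ n (y z : Y), (∀ k, R.mkQ (T^[k] y) = R.mkQ (T^[k] z) ∧ ‖T^[k] y‖ = ‖T^[k] z‖) →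
      ‖R'.mkQ (y - z)‖ ≤ (1 / 2) ^ n * (‖y‖ + ‖z‖) := by
    intro n
    induction n with
    | zero =>
      intro y z _
      rw [pow_zero, one_mul]
      exact (norm_mkQ_le _ _).trans (norm_sub_le _ _)
    | succ n ih =>
      intro y z hyz
      have h1 := ih (T y) (T z) fun k => hyz (k + 1)
      have h2 : w y = w z := by
        obtain ⟨h3, h4⟩ := hyz 0
        simp only [Function.iterate_zero, id_eq] at h3 h4
        simp only [w, h3, h4]
      have h3 : R'.mkQ (y - z) = R'.mkQ (T y - T z) := by
        rw [← sub_eq_zero, ← map_sub, ← LinearMap.mem_ker, Submodule.ker_mkQ]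
        convert R'.sub_mem (hTm y) (hTm z) using 1
        rw [h2]
        abel
      rw [h3]
      refine h1.trans ?_
      rw [pow_succ, mul_assoc]
      gcongr
      linarith [hTn y, hTn z]
  let code : Y ⧸ R' → ℕ → (Y ⧸ R) × ℝ := fun q k =>
    (R.mkQ (T^[k] (Quotient.out q)), ‖T^[k] (Quotient.out q)‖)
  have hinj : Function.Injective code := by
    intro p q hpq
    have h1 := fun n => hiter n (Quotient.out p) (Quotient.out q) fun k =>
      Prod.ext_iff.1 (congrFun hpq k)
    have h2 : ‖R'.mkQ (Quotient.out p - Quotient.out q)‖ ≤ 0 := by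
      have h2 := (tendsto_pow_atTop_nhds_zero_of_lt_one (by norm_num : (0 : ℝ) ≤ 1 / 2)
        (by norm_num)).mul_const (‖Quotient.out p‖ + ‖Quotient.out q‖)
      rw [zero_mul] at h2
      exact ge_of_tendsto' h2 h1
    rw [norm_mkQ_eq_infDist] at h2
    have h3 : Quotient.out p - Quotient.out q ∈ R' :=
      (hR'.mem_iff_infDist_zero ⟨0, R'.zero_mem⟩).2 (le_antisymm h2 infDist_nonneg)
    rw [← Quotient.out_eq p, ← Quotient.out_eq q]
    exact (Submodule.Quotient.eq R').2 h3
  have := Cardinal.mk_le_of_injective hinj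
  simpa [Cardinal.mk_real] using this

theorem mk_quotient_le_of_sup {R F : Submodule ℂ Y} [FiniteDimensional ℂ F] :
    Cardinal.mk (Y ⧸ R) ≤ Cardinal.mk (Y ⧸ (R ⊔ F)) * Cardinal.continuum := by
  have hsurj : Function.Surjective fun p : (Y ⧸ (R ⊔ F)) × F =>
      R.mkQ (Quotient.out p.1 + (p.2 : Y)) := by
    intro q
    obtain ⟨y, rfl⟩ := R.mkQ_surjective q
    have h1 : y - Quotient.out ((R ⊔ F).mkQ y) ∈ R ⊔ F := by
      rw [← Submodule.Quotient.eq]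
      exact (Quotient.out_eq ((R ⊔ F).mkQ y)).symm
    obtain ⟨r, hr, φ, hφ, hsum⟩ := Submodule.mem_sup.1 h1
    refine ⟨((R ⊔ F).mkQ y, ⟨φ, hφ⟩), ?_⟩
    refine ((Submodule.Quotient.eq R).2 ?_).symm
    rwa [← sub_sub, ← hsum, add_sub_cancel_right]
  have h1 := Cardinal.mk_le_of_surjective hsurj
  rw [Cardinal.mk_prod, Cardinal.lift_id, Cardinal.lift_id] at h1
  refine h1.trans (mul_le_mul_right ?_ _)
  have e := (Module.finBasis ℂ F).equivFun.toEquiv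
  have h2 := Cardinal.mk_congr_lift e
  rw [Cardinal.mk_pi, Cardinal.prod_const, Cardinal.mk_complex] at h2
  have h3 : Cardinal.lift.{0} (Cardinal.mk F) ≤ Cardinal.continuum := by
    rw [h2]
    simp only [Cardinal.lift_power, Cardinal.lift_continuum, Cardinal.mk_fin, Cardinal.lift_natCast]
    rw [Cardinal.power_natCast]
    exact Cardinal.power_nat_le Cardinal.aleph0_le_continuum
  rwa [Cardinal.lift_uzero] at h3

end Step

section Homotopy

variable {X Y : Type*} [NormedAddCommGroup X] [NormedSpace ℂ X] [CompleteSpace X]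
  [NormedAddCommGroup Y] [NormedSpace ℂ Y] [CompleteSpace Y]

namespace RelBounds

variable {A B : Submodule ℂ (X × Y)} {γ C : ℝ} (h : RelBounds A B γ C)

include h

omit [CompleteSpace X] [CompleteSpace Y] in
theorem exists_relMulS_norm_sub_le {x : X} {z : Y} (hz : (x, z) ∈ B) :
    ∃ a ∈ relMulS A, ‖z - a‖ ≤ (C + 1) * ‖x‖ := by
  have h1 := h.upper x z hz
  have hC := h.nonneg
  rcases eq_or_ne x 0 with rfl | hx
  · rw [norm_zero, mul_zero, norm_mkQ_eq_infDist] at h1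
    exact ⟨z, (h.isClosed_relMulS.mem_iff_infDist_zero ⟨0, Submodule.zero_mem _⟩).2
      (le_antisymm h1 infDist_nonneg), by simp⟩
  · have hx' := norm_pos_iff.2 hx
    rw [norm_mkQ_eq_infDist] at h1
    obtain ⟨a, ha, hlt⟩ := (infDist_lt_iff (s := (relMulS A : Set Y)) (x := z)
      (r := (C + 1) * ‖x‖) ⟨0, Submodule.zero_mem _⟩).1 (by linarith)
    exact ⟨a, ha, by rw [← dist_eq_norm]; exact hlt.le⟩

theorem mk_quotient_le_of_norm_sub_le {s t : ℂ} (hs : ‖s‖ ≤ 1) (ht : ‖t‖ ≤ 1)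
    (hst : 4 * (‖t - s‖ * (C + 1)) ≤ (γ - C) / 2 ^ (Module.finrank ℂ (relKerS A) + 1)) :
    Cardinal.mk (Y ⧸ relRanS (addRel A (smulRel t B))) ≤
      (Cardinal.mk (Y ⧸ relRanS (addRel A (smulRel s B))) * Cardinal.continuum *
        Cardinal.continuum) ^ Cardinal.aleph0 := by
  obtain ⟨R, F, -, hF, hsup, hR⟩ := (h.smul hs).exists_isClosed_sup
  rw [hsup]
  refine (_root_.mk_quotient_le_of_norm_sub_le (R := R) (h.smul ht).isClosed_relRanS ?_).trans
    (Cardinal.power_le_power_right (mul_le_mul_left mk_quotient_le_of_sup _))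
  intro r hr
  obtain ⟨x, hx, hle⟩ := hR r hr
  obtain ⟨y, w, hA, hB, rfl⟩ := mem_addRel.1 hx
  obtain ⟨z, hz, rfl⟩ := mem_smulRel.1 hB
  obtain ⟨a, ha, haz⟩ := h.exists_relMulS_norm_sub_le hz
  have ha' : ((0 : X), a) ∈ A := ha
  refine ⟨y + s • z + (t - s) • (z - a), ⟨(x, y + s • z + (t - s) • (z - a)), mem_addRel.2
    ⟨y - (t - s) • a, t • z, ?_, mem_smulRel.2 ⟨z, hz, rfl⟩, ?_⟩, rfl⟩, ?_⟩
  · simpa using A.sub_mem hA (A.smul_mem (t - s) ha')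
  · module
  · rw [sub_add_cancel_left, norm_neg, norm_smul]
    have h1 : ‖t - s‖ * ‖z - a‖ ≤ ‖t - s‖ * ((C + 1) * ‖x‖) := by gcongr
    have h2 := mul_le_mul_of_nonneg_right hst (norm_nonneg x)
    linarith

theorem mk_quotient_le {κ : Cardinal} (hκ : Cardinal.mk (Y ⧸ relRanS A) ≤ κ)
    (hc : Cardinal.continuum ≤ κ) (hpow : κ ^ Cardinal.aleph0 ≤ κ) :
    Cardinal.mk (Y ⧸ relRanS (addRel A B)) ≤ κ := by
  have hC := h.nonneg
  have hε : 0 < (γ - C) / 2 ^ (Module.finrank ℂ (relKerS A) + 1) :=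
    div_pos (sub_pos.2 h.lt) (by positivity)
  obtain ⟨M, hM⟩ := exists_nat_ge
    (4 * (C + 1) / ((γ - C) / 2 ^ (Module.finrank ℂ (relKerS A) + 1)))
  rw [div_le_iff₀ hε] at hM
  have hM0 : (0 : ℝ) < M := by
    by_contra hneg
    have := mul_nonpos_of_nonpos_of_nonneg (not_lt.1 hneg) hε.le
    linarith
  have hnorm : ∀ k ≤ M, ‖(k / M : ℂ)‖ ≤ 1 := fun k hk => by
    rw [norm_div, Complex.norm_natCast, Complex.norm_natCast]
    exact div_le_one_of_le₀ (by exact_mod_cast hk) hM0.le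
  have hκ0 := Cardinal.aleph0_le_continuum.trans hc
  have key : ∀ k ≤ M, Cardinal.mk (Y ⧸ relRanS (addRel A (smulRel (k / M : ℂ) B))) ≤ κ := by
    intro k
    induction k with
    | zero =>
      intro _
      rwa [Nat.cast_zero, zero_div, h.addRel_smulRel_zero_range]
    | succ k ih =>
      intro hk
      refine (h.mk_quotient_le_of_norm_sub_le (hnorm k (by omega)) (hnorm _ hk) ?_).trans
        (le_trans ?_ hpow)
      · have : ((k + 1 : ℕ) / M - k / M : ℂ) = 1 / M := by push_cast; ring
        rw [this, norm_div, norm_one, Complex.norm_natCast, one_div_mul_eq_div, ← mul_div_assoc,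
          div_le_iff₀ hM0]
        linarith
      · refine Cardinal.power_le_power_right ?_
        calc _ ≤ κ * κ * κ := by gcongr; exact ih (by omega)
          _ = κ := by rw [Cardinal.mul_eq_self hκ0, Cardinal.mul_eq_self hκ0]
  have := key M le_rfl
  rwa [div_self (by exact_mod_cast hM0.ne'), smulRel_one] at this

theorem rank_quotient_le (hcl : IsClosed (relRanS A : Set Y)) :
    Module.rank ℂ (Y ⧸ relRanS (addRel A B)) ≤ Module.rank ℂ (Y ⧸ relRanS A) := by
  rcases lt_or_ge (Module.rank ℂ (Y ⧸ relRanS A)) Cardinal.aleph0 with hfin | hinf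
  · exact h.rank_quotient_le_of_finite h.isClosed_relRanS hfin
  · have : IsClosed ((relRanS A).toAddSubgroup : Set Y) := hcl
    have hcs : CompleteSpace (Y ⧸ relRanS A) := inferInstance
    let inst : NormedAddCommGroup (Y ⧸ relRanS A) :=
      Submodule.Quotient.normedAddCommGroup (relRanS A)
    have hnt : Nontrivial (Y ⧸ relRanS A) :=
      rank_pos_iff_nontrivial.1 (Cardinal.aleph0_pos.trans_le hinf)
    refine (rank_le_card ℂ _).trans ?_
    rw [← mk_eq_rank hinf]
    refine h.mk_quotient_le le_rfl ?_ mk_power_aleph0_le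
    rw [mk_eq_rank hinf]
    exact continuum_le_rank hinf

end RelBounds

end Homotopy

theorem relRan_eq_relRanS {X Y : Type*} [AddCommGroup X] [Module ℂ X] [AddCommGroup Y]
    [Module ℂ Y] (A : Submodule ℂ (X × Y)) : relRan A = relRanS A := by
  ext y
  simp [relRan, relRanS]

theorem stmt14 {X Y : Type*} [NormedAddCommGroup X] [NormedSpace ℂ X] [CompleteSpace X]
    [NormedAddCommGroup Y] [NormedSpace ℂ Y] [CompleteSpace Y]
    (A B : Submodule ℂ (X × Y))
    (hA : IsClosed (A : Set (X × Y))) (hB : IsClosed (B : Set (X × Y)))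
    (hRA : IsClosed (relRan A))
    (hα : Module.rank ℂ ↥(relKerS A) < Cardinal.aleph0)
    (γ : ℝ) (hγ : 0 < γ)
    (hlb : ∀ x y, (x, y) ∈ A → γ * infDist x (relKer A) ≤ infDist y (closure (relMul0 A)))
    (hdom : relDom A ⊆ relDom B) (h0 : relMul0 B ⊆ relMul0 A)
    (C : ℝ) (hC0 : 0 ≤ C) (hCγ : C < γ)
    (hbdd : ∀ x z, (x, z) ∈ B → infDist z (relMul0 B) ≤ C * ‖x‖) :
    IsClosed ((addRel A B : Submodule ℂ (X × Y)) : Set (X × Y)) ∧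
    IsClosed (relRan (addRel A B)) ∧
    Module.rank ℂ ↥(relKerS (addRel A B)) ≤ Module.rank ℂ ↥(relKerS A) ∧
    Module.rank ℂ (Y ⧸ relRanS (addRel A B)) ≤ Module.rank ℂ (Y ⧸ relRanS A) := by
  have h := RelBounds.of_infDist hA hα hγ hlb hdom h0 hC0 hCγ hbdd
  rw [relRan_eq_relRanS] at hRA ⊢
  exact ⟨h.isClosed_addRel, h.isClosed_relRanS, h.rank_relKerS_le, h.rank_quotient_le hRA⟩
end

section
/- Let X and Y be complex Banach spaces. Let A be a closed linear relation from X to Y with closed range R(A), let γ > 0 be a lower bound for A, and let B be a closed linear relation from X to Y with D(A) ⊆ D(B), B(0) ⊆ A(0), which is relatively bounded with respect to A with constants σ, τ ≥ 0. Assume ν(A : B) = ∞, i.e. N(A) ⊆ M_n for every n ≥ 0. Then for every λ ∈ ℂ with |λ|·(σ + τγ) < γ, the gap satisfies δ(N(A), N(A − λB)) ≤ σ|λ| / (γ − |λ|·(σ + τγ)); that is, dist(u, N(A − λB)) ≤ [σ|λ| / (γ − |λ|·(σ + τγ))]·‖u‖ for every u ∈ N(A). -/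
open Metric Set

section Defs

variable {X Y : Type*} [AddCommGroup X] [Module ℂ X] [AddCommGroup Y] [Module ℂ Y]

/-- The linear relation `A - λB`, with graph
`{(x, y - λ • z) : (x, y) ∈ G(A), (x, z) ∈ G(B)}`. -/
def subRel (lam : ℂ) (A B : Submodule ℂ (X × Y)) : Submodule ℂ (X × Y) where
  carrier := {p | ∃ y z, (p.1, y) ∈ A ∧ (p.1, z) ∈ B ∧ p.2 = y - lam • z}
  add_mem' := by
    rintro ⟨x₁, w₁⟩ ⟨x₂, w₂⟩ ⟨y₁, z₁, hA₁, hB₁, rfl⟩ ⟨y₂, z₂, hA₂, hB₂, rfl⟩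
    refine ⟨y₁ + y₂, z₁ + z₂, A.add_mem hA₁ hA₂, B.add_mem hB₁ hB₂, ?_⟩
    show (y₁ - lam • z₁) + (y₂ - lam • z₂) = (y₁ + y₂) - lam • (z₁ + z₂)
    rw [smul_add]; abel
  zero_mem' := ⟨0, 0, A.zero_mem, B.zero_mem, by simp⟩
  smul_mem' := by
    rintro c ⟨x, w⟩ ⟨y, z, hA, hB, rfl⟩
    refine ⟨c • y, c • z, A.smul_mem c hA, B.smul_mem c hB, ?_⟩
    show c • (y - lam • z) = c • y - lam • (c • z)
    rw [smul_sub, smul_comm]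

end Defs

section MseqLemmas

variable {X Y : Type*} [AddCommGroup X] [Module ℂ X] [AddCommGroup Y] [Module ℂ Y]

theorem Mseq_sub_mem (A B : Submodule ℂ (X × Y)) :
    ∀ n : ℕ, ∀ x₁ ∈ Mseq A B n, ∀ x₂ ∈ Mseq A B n, x₁ - x₂ ∈ Mseq A B n
  | 0 => fun _ _ _ _ => mem_univ _
  | n + 1 => by
    rintro x₁ ⟨z₁, ⟨w₁, hw₁, hA₁⟩, hB₁⟩ x₂ ⟨z₂, ⟨w₂, hw₂, hA₂⟩, hB₂⟩
    exact ⟨z₁ - z₂, ⟨w₁ - w₂, Mseq_sub_mem A B n w₁ hw₁ w₂ hw₂, A.sub_mem hA₁ hA₂⟩,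
      B.sub_mem hB₁ hB₂⟩

theorem mem_Mseq_of_mem_Mseq_succ {A B : Submodule ℂ (X × Y)} (h0 : relMul0 B ⊆ relMul0 A)
    {n : ℕ} (hn : relKer A ⊆ Mseq A B n) {x w : X} {z : Y} (hx : x ∈ Mseq A B (n + 1))
    (hxz : (x, z) ∈ B) (hwz : (w, z) ∈ A) : w ∈ Mseq A B n := by
  obtain ⟨z', ⟨w', hw', hA'⟩, hB'⟩ := hx
  have h1 : ((0 : X), z' - z) ∈ A := h0 (by
    have := B.sub_mem hB' hxz
    simpa [relMul0] using this)
  have h2 : w' - w ∈ relKer A := by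
    have := A.sub_mem (A.sub_mem hA' hwz) h1
    simpa [relKer] using this
  have := Mseq_sub_mem A B n w' hw' _ (hn h2)
  simpa using this

end MseqLemmas

theorem exists_norm_sub_le_mul_of_infDist_le {E : Type*} [NormedAddCommGroup E]
    {S : Set E} (hS : IsClosed S) (hne : S.Nonempty) {x : E} {c k : ℝ} (hk : 1 < k)
    (h : infDist x S ≤ c) : ∃ s ∈ S, ‖x - s‖ ≤ k * c := by
  have hc : 0 ≤ c := infDist_nonneg.trans h
  rcases hc.eq_or_lt with rfl | hc
  · refine ⟨x, (hS.mem_iff_infDist_zero hne).2 (le_antisymm h infDist_nonneg), by simp⟩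
  · have : infDist x S < k * c := by nlinarith
    obtain ⟨s, hs, hd⟩ := (infDist_lt_iff hne).1 this
    exact ⟨s, hs, by rw [← dist_eq_norm]; exact hd.le⟩

section Perturbation

variable {X Y : Type*} [NormedAddCommGroup X] [NormedSpace ℂ X]
  [NormedAddCommGroup Y] [NormedSpace ℂ Y]

theorem isClosed_relKer {A : Submodule ℂ (X × Y)} (hA : IsClosed (A : Set (X × Y))) :
    IsClosed (relKer A) :=
  hA.preimage (f := fun x : X => (x, (0 : Y))) (by fun_prop)

theorem isClosed_relMul0 {A : Submodule ℂ (X × Y)} (hA : IsClosed (A : Set (X × Y))) :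
    IsClosed (relMul0 A) :=
  hA.preimage (f := fun y : Y => ((0 : X), y)) (by fun_prop)

theorem zero_mem_relMul0 (A : Submodule ℂ (X × Y)) : (0 : Y) ∈ relMul0 A := A.zero_mem

theorem zero_mem_relKer (A : Submodule ℂ (X × Y)) : (0 : X) ∈ relKer A := A.zero_mem

/-- The bound on `dist(B x, B(0))` provided by relative boundedness, for `p = (x, y)` in the graph
of `A`. -/
noncomputable def relBound (A : Submodule ℂ (X × Y)) (σ τ : ℝ) (p : X × Y) : ℝ :=
  σ * ‖p.1‖ + τ * infDist p.2 (closure (relMul0 A))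

/-- One step of the construction of a formal power series solution of `A u = λ B u`. -/
theorem exists_next {A B : Submodule ℂ (X × Y)}
    (hA : IsClosed (A : Set (X × Y))) (hB : IsClosed (B : Set (X × Y)))
    {γ : ℝ} (hγ : 0 < γ)
    (hlb : ∀ x y, (x, y) ∈ A → γ * infDist x (relKer A) ≤ infDist y (closure (relMul0 A)))
    (hdom : relDom A ⊆ relDom B) (h0 : relMul0 B ⊆ relMul0 A) {σ τ : ℝ}
    (hrb : ∀ x y, (x, y) ∈ A → ∀ z, (x, z) ∈ B →
      infDist z (closure (relMul0 B)) ≤ σ * ‖x‖ + τ * infDist y (closure (relMul0 A)))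
    (hν : ∀ n : ℕ, relKer A ⊆ Mseq A B n) {k : ℝ} (hk : 1 < k)
    {p : X × Y} (hp : p ∈ A) (hpM : ∀ n, p.1 ∈ Mseq A B n) :
    ∃ q : X × Y, q ∈ A ∧ (∀ n, q.1 ∈ Mseq A B n) ∧ (p.1, q.2) ∈ B ∧
      ‖q.2‖ ≤ k * relBound A σ τ p ∧ ‖q.1‖ ≤ k / γ * relBound A σ τ p ∧
      infDist q.2 (closure (relMul0 A)) ≤ relBound A σ τ p := by
  obtain ⟨x, y⟩ := p
  obtain ⟨z₀, hz₀⟩ := hdom ⟨y, hp⟩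
  have hd₀ := hrb x y hp z₀ hz₀
  obtain ⟨s, hs, hzs⟩ := exists_norm_sub_le_mul_of_infDist_le isClosed_closure
    ⟨0, subset_closure (zero_mem_relMul0 B)⟩ hk hd₀
  rw [(isClosed_relMul0 hB).closure_eq] at hs
  have hz : (x, z₀ - s) ∈ B := by simpa using B.sub_mem hz₀ hs
  have hdz : infDist (z₀ - s) (closure (relMul0 A)) ≤ relBound A σ τ (x, y) :=
    (infDist_le_infDist_of_subset (closure_mono h0)
      ⟨0, subset_closure (zero_mem_relMul0 B)⟩).trans (hrb x y hp _ hz)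
  obtain ⟨z', ⟨w', hw', hA'⟩, hB'⟩ := hpM 1
  have hw : (w', z₀ - s) ∈ A := by
    have h1 : ((0 : X), z' - (z₀ - s)) ∈ A := h0 (by simpa [relMul0] using B.sub_mem hB' hz)
    simpa using A.sub_mem hA' h1
  have hdw : infDist w' (relKer A) ≤ relBound A σ τ (x, y) / γ := by
    rw [le_div_iff₀ hγ, mul_comm]
    exact (hlb _ _ hw).trans hdz
  obtain ⟨v, hv, hwv⟩ := exists_norm_sub_le_mul_of_infDist_le (isClosed_relKer hA)
    ⟨0, zero_mem_relKer A⟩ hk hdw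
  have hwvA : (w' - v, z₀ - s) ∈ A := by simpa using A.sub_mem hw hv
  refine ⟨(w' - v, z₀ - s), hwvA, fun n => ?_, hz, hzs, hwv.trans_eq (by ring), hdz⟩
  exact mem_Mseq_of_mem_Mseq_succ h0 (hν n) (hpM (n + 1)) hz hwvA

/-- The sum of a power series whose coefficients satisfy `A uₙ₊₁ ∋ zₙ₊₁ ∈ B uₙ` lies in
`N(A - λB)`. -/
theorem tsum_mem_relKer_subRel {A B : Submodule ℂ (X × Y)}
    (hA : IsClosed (A : Set (X × Y))) (hB : IsClosed (B : Set (X × Y))) {lam : ℂ}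
    {f : ℕ → X × Y} (hf0 : (f 0).2 = 0) (hfA : ∀ n, f n ∈ A)
    (hfB : ∀ n, ((f n).1, (f (n + 1)).2) ∈ B)
    (hx : Summable fun n => lam ^ n • (f n).1)
    (hz : Summable fun n => lam ^ n • (f (n + 1)).2) :
    ∑' n, lam ^ n • (f n).1 ∈ relKer (subRel lam A B) := by
  have hxs := hx.hasSum
  have hzs := hz.hasSum
  have hy : HasSum (fun n => lam ^ n • (f n).2) (lam • ∑' n, lam ^ n • (f (n + 1)).2) := by
    rw [← hasSum_nat_add_iff' 1]
    simpa [hf0, pow_succ', mul_smul] using hzs.const_smul lam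
  have mem_of_hasSum {C : Submodule ℂ (X × Y)} (hC : IsClosed (C : Set (X × Y)))
      {g : ℕ → X × Y} (hg : ∀ n, g n ∈ C) {a : X × Y} (ha : HasSum g a) : a ∈ C :=
    hC.mem_of_tendsto ha (.of_forall fun s => C.sum_mem fun n _ => hg n)
  exact ⟨_, _, mem_of_hasSum hA (fun n => A.smul_mem (lam ^ n) (hfA n)) (hxs.prodMk hy),
    mem_of_hasSum hB (fun n => B.smul_mem (lam ^ n) (hfB n)) (hxs.prodMk hzs), by simp⟩

theorem infDist_relKer_subRel_le [CompleteSpace X] [CompleteSpace Y] {A B : Submodule ℂ (X × Y)}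
    (hA : IsClosed (A : Set (X × Y))) (hB : IsClosed (B : Set (X × Y)))
    {γ : ℝ} (hγ : 0 < γ)
    (hlb : ∀ x y, (x, y) ∈ A → γ * infDist x (relKer A) ≤ infDist y (closure (relMul0 A)))
    (hdom : relDom A ⊆ relDom B) (h0 : relMul0 B ⊆ relMul0 A) {σ τ : ℝ}
    (hσ : 0 ≤ σ) (hτ : 0 ≤ τ)
    (hrb : ∀ x y, (x, y) ∈ A → ∀ z, (x, z) ∈ B →
      infDist z (closure (relMul0 B)) ≤ σ * ‖x‖ + τ * infDist y (closure (relMul0 A)))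
    (hν : ∀ n : ℕ, relKer A ⊆ Mseq A B n) {k : ℝ} (hk : 1 < k) {lam : ℂ}
    (hlam : ‖lam‖ * (σ * (k / γ) + τ) < 1) {u : X} (hu : u ∈ relKer A) :
    infDist u (relKer (subRel lam A B)) ≤
      ‖lam‖ * (k / γ) * (σ * ‖u‖) * (1 - ‖lam‖ * (σ * (k / γ) + τ))⁻¹ := by
  set q := σ * (k / γ) + τ with hq
  have hk0 : 0 ≤ k := by linarith
  have hkγ : 0 ≤ k / γ := by positivity
  have hq0 : 0 ≤ q := by positivity
  choose next hnext using fun p : {p : X × Y // p ∈ A ∧ ∀ n, p.1 ∈ Mseq A B n} =>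
    exists_next hA hB hγ hlb hdom h0 hrb hν hk p.2.1 p.2.2
  let step (p : {p : X × Y // p ∈ A ∧ ∀ n, p.1 ∈ Mseq A B n}) :
      {p : X × Y // p ∈ A ∧ ∀ n, p.1 ∈ Mseq A B n} :=
    ⟨next p, (hnext p).1, (hnext p).2.1⟩
  let f (n : ℕ) : X × Y := (step^[n] ⟨(u, 0), hu, fun n => hν n hu⟩).1
  have hf0 : f 0 = (u, 0) := rfl
  have hfA (n : ℕ) : f n ∈ A := (step^[n] ⟨(u, 0), hu, fun n => hν n hu⟩).2.1
  have hstep (n : ℕ) : ((f n).1, (f (n + 1)).2) ∈ B ∧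
      ‖(f (n + 1)).2‖ ≤ k * relBound A σ τ (f n) ∧
      ‖(f (n + 1)).1‖ ≤ k / γ * relBound A σ τ (f n) ∧
      infDist (f (n + 1)).2 (closure (relMul0 A)) ≤ relBound A σ τ (f n) := by
    have := (hnext (step^[n] ⟨(u, 0), hu, fun n => hν n hu⟩)).2.2
    simp only [f, Function.iterate_succ_apply']
    exact this
  have hbound (n : ℕ) : relBound A σ τ (f n) ≤ q ^ n * (σ * ‖u‖) := by
    induction n with
    | zero =>
      simp [hf0, relBound, infDist_zero_of_mem (subset_closure (zero_mem_relMul0 A))]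
    | succ n ih =>
      obtain ⟨-, -, h1, h2⟩ := hstep n
      calc relBound A σ τ (f (n + 1))
          ≤ σ * (k / γ * relBound A σ τ (f n)) + τ * relBound A σ τ (f n) := by
            unfold relBound at h1 h2 ⊢
            gcongr
        _ = q * relBound A σ τ (f n) := by rw [hq]; ring
        _ ≤ q * (q ^ n * (σ * ‖u‖)) := by gcongr
        _ = q ^ (n + 1) * (σ * ‖u‖) := by ring
  have hgeom : HasSum (fun n => (‖lam‖ * q) ^ n) (1 - ‖lam‖ * q)⁻¹ :=
    hasSum_geometric_of_lt_one (by positivity) hlam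
  have hxn (n : ℕ) : ‖lam ^ (n + 1) • (f (n + 1)).1‖ ≤
      ‖lam‖ * (k / γ) * (σ * ‖u‖) * (‖lam‖ * q) ^ n := by
    rw [norm_smul, norm_pow]
    calc ‖lam‖ ^ (n + 1) * ‖(f (n + 1)).1‖
        ≤ ‖lam‖ ^ (n + 1) * (k / γ * (q ^ n * (σ * ‖u‖))) := by
          gcongr
          exact (hstep n).2.2.1.trans (by gcongr; exact hbound n)
      _ = ‖lam‖ * (k / γ) * (σ * ‖u‖) * (‖lam‖ * q) ^ n := by ring
  have hzn (n : ℕ) : ‖lam ^ n • (f (n + 1)).2‖ ≤ k * (σ * ‖u‖) * (‖lam‖ * q) ^ n := by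
    rw [norm_smul, norm_pow]
    calc ‖lam‖ ^ n * ‖(f (n + 1)).2‖
        ≤ ‖lam‖ ^ n * (k * (q ^ n * (σ * ‖u‖))) := by
          gcongr
          exact (hstep n).2.1.trans (by gcongr; exact hbound n)
      _ = k * (σ * ‖u‖) * (‖lam‖ * q) ^ n := by ring
  have hx : Summable fun n => lam ^ n • (f n).1 :=
    (summable_nat_add_iff 1).1 (.of_norm_bounded (hgeom.summable.mul_left _) hxn)
  have hmem := tsum_mem_relKer_subRel hA hB (by rw [hf0]) hfA (fun n => (hstep n).1) hx
    (.of_norm_bounded (hgeom.summable.mul_left _) hzn)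
  refine (infDist_le_dist_of_mem hmem).trans ?_
  rw [dist_comm, dist_eq_norm, hx.tsum_eq_zero_add]
  simpa [hf0] using tsum_of_norm_bounded (hgeom.mul_left _) hxn

end Perturbation

theorem stmt17 {X Y : Type*} [NormedAddCommGroup X] [NormedSpace ℂ X] [CompleteSpace X]
    [NormedAddCommGroup Y] [NormedSpace ℂ Y] [CompleteSpace Y]
    (A B : Submodule ℂ (X × Y))
    (hA : IsClosed (A : Set (X × Y))) (hB : IsClosed (B : Set (X × Y)))
    (hRA : IsClosed (relRan A))
    (γ : ℝ) (hγ : 0 < γ)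
    (hlb : ∀ x y, (x, y) ∈ A → γ * infDist x (relKer A) ≤ infDist y (closure (relMul0 A)))
    (hdom : relDom A ⊆ relDom B) (h0 : relMul0 B ⊆ relMul0 A)
    (σ τ : ℝ) (hσ : 0 ≤ σ) (hτ : 0 ≤ τ)
    (hrb : ∀ x y, (x, y) ∈ A → ∀ z, (x, z) ∈ B →
      infDist z (closure (relMul0 B)) ≤ σ * ‖x‖ + τ * infDist y (closure (relMul0 A)))
    (hν : ∀ n : ℕ, relKer A ⊆ Mseq A B n) :
    ∀ lam : ℂ, ‖lam‖ * (σ + τ * γ) < γ →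
      ∀ u ∈ relKer A, infDist u (relKer (subRel lam A B)) ≤
        (σ * ‖lam‖ / (γ - ‖lam‖ * (σ + τ * γ))) * ‖u‖ := by
  intro lam hlam u hu
  have hlt : ‖lam‖ * (σ * (1 / γ) + τ) < 1 := by
    have : ‖lam‖ * (σ * (1 / γ) + τ) = ‖lam‖ * (σ + τ * γ) / γ := by field_simp
    rwa [this, div_lt_one hγ]
  have hval : σ * ‖lam‖ / (γ - ‖lam‖ * (σ + τ * γ)) * ‖u‖ =
      ‖lam‖ * (1 / γ) * (σ * ‖u‖) * (1 - ‖lam‖ * (σ * (1 / γ) + τ))⁻¹ := by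
    have h1 : γ - ‖lam‖ * (σ + τ * γ) = γ * (1 - ‖lam‖ * (σ * (1 / γ) + τ)) := by
      field_simp
    rw [h1, div_eq_mul_inv, mul_inv]
    ring
  have hcont : ContinuousAt (fun k : ℝ =>
      ‖lam‖ * (k / γ) * (σ * ‖u‖) * (1 - ‖lam‖ * (σ * (k / γ) + τ))⁻¹) 1 :=
    ContinuousAt.mul (by fun_prop) (ContinuousAt.inv₀ (by fun_prop) (by linarith))
  have hev : ∀ᶠ k : ℝ in nhdsWithin 1 (Ioi 1), ‖lam‖ * (σ * (k / γ) + τ) < 1 :=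
    nhdsWithin_le_nhds (ContinuousAt.eventually_lt (by fun_prop) continuousAt_const hlt)
  rw [hval]
  refine ge_of_tendsto (hcont.tendsto.mono_left (nhdsWithin_le_nhds (s := Ioi 1))) ?_
  filter_upwards [hev, self_mem_nhdsWithin] with k hk hk1
  exact infDist_relKer_subRel_le hA hB hγ hlb hdom h0 hσ hτ hrb hν hk1 hk hu
end
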